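/- arXiv:math/9905051 — 2 statements merged into one kernel-verified Lean document; each statement's English description precedes it below -/
import Mathlib

section
/- Let n be a positive integer, let P_1, …, P_n be polynomials in ℂ[x_1, …, x_n], and let ν be a positive integer with ν < n. Assume that the zero set of {P_1, …, P_n} in ℂ^n equals the zero set of {P_1, …, P_ν} in ℂ^n (equivalently, P_{ν+1}, …, P_n vanish at every common zero of P_1, …, P_ν). Then the Jacobian J(P_1, …, P_n) belongs to the ideal of ℂ[x_1, …, x_n] generated by P_1, …, P_n; that is, there exist polynomials A_1, …, A_n ∈ ℂ[x_1, …, x_n] with J(P_1, …, P_n) = A_1 P_1 + ⋯ + A_n P_n. -/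
open MvPolynomial

open scoped TensorProduct in
lemma jac_trace_lemma {K A : Type*} [Field K] [CommRing A] [Algebra K A] [Module.Finite K A]
    (D : A ⊗[K] A) (h : ∀ a : A, (a ⊗ₜ[K] (1 : A)) * D = ((1 : A) ⊗ₜ[K] a) * D)
    (f : A →ₗ[K] K) :
    ∃ u : A, LinearMap.trace K A (LinearMap.mulLeft K u) =
      f (Algebra.TensorProduct.lmul' K (S := A) D) ∧
      ∀ l : A, (∀ a, f (l * a) = 0) → l * u = 0 := by
  let Φ : A ⊗[K] A →ₗ[K] A := (TensorProduct.lid K A).toLinearMap ∘ₗ f.rTensor A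
  have hΦ : ∀ x y, Φ (x ⊗ₜ y) = f x • y := fun x y => by simp [Φ]
  have h1 : ∀ (w : A) (t : A ⊗[K] A), Φ (((1 : A) ⊗ₜ[K] w) * t) = w * Φ t := by
    intro w t
    induction t with
    | zero => simp
    | add x y hx hy => rw [mul_add, map_add, map_add, hx, hy, mul_add]
    | tmul x y => simp [hΦ]
  let T : A ⊗[K] A →ₗ[K] (A →ₗ[K] A) :=
    dualTensorHom K A A ∘ₗ ((LinearMap.mul K A).compr₂ f).rTensor A
  have hT : ∀ (w : A) (t : A ⊗[K] A), T t w = Φ ((w ⊗ₜ[K] (1 : A)) * t) := by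
    intro w t
    induction t with
    | zero => simp
    | add x y hx hy => rw [mul_add, map_add, map_add, LinearMap.add_apply, hx, hy]
    | tmul x y => simp [hΦ, T, dualTensorHom_apply, mul_comm]
  have htr : ∀ t : A ⊗[K] A, LinearMap.trace K A (T t) =
      f (Algebra.TensorProduct.lmul' K (S := A) t) := by
    intro t
    induction t with
    | zero => simp
    | add x y hx hy => simp only [map_add, hx, hy]
    | tmul x y => simp [T, LinearMap.trace_eq_contract_apply]
  refine ⟨Φ D, ?_, ?_⟩
  · rw [← htr]
    congr 1
    ext w
    rw [hT, h, h1, LinearMap.mulLeft_apply, mul_comm]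
  · intro l hl
    rw [← h1, ← h]
    have : ∀ t : A ⊗[K] A, Φ ((l ⊗ₜ[K] (1 : A)) * t) = 0 := by
      intro t
      induction t with
      | zero => simp
      | add x y hx hy => rw [mul_add, map_add, hx, hy, add_zero]
      | tmul x y => simp [hΦ, hl]
    exact this D

open scoped TensorProduct in
lemma jac_diff_lemma {K A : Type*} [Field K] [CommRing A] [Algebra K A] {n : ℕ}
    (φ : MvPolynomial (Fin n) K →ₐ[K] A) (p : MvPolynomial (Fin n) K) :
    ∃ D : Fin n → A ⊗[K] A,
      φ p ⊗ₜ[K] (1 : A) - (1 : A) ⊗ₜ[K] φ p =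
        ∑ j, D j * (φ (X j) ⊗ₜ[K] (1 : A) - (1 : A) ⊗ₜ[K] φ (X j)) ∧
      ∀ j, Algebra.TensorProduct.lmul' K (S := A) (D j) = φ (pderiv j p) := by
  induction p using MvPolynomial.induction_on with
  | C a =>
    refine ⟨fun _ => 0, ?_, by simp⟩
    have : φ (C a) = a • (1 : A) := by
      rw [← MvPolynomial.algebraMap_eq, AlgHom.commutes, Algebra.algebraMap_eq_smul_one]
    simp [this, TensorProduct.smul_tmul]
  | add p q hp hq =>
    obtain ⟨D, h1, h2⟩ := hp
    obtain ⟨E, h3, h4⟩ := hq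
    refine ⟨fun j => D j + E j, ?_, fun j => by simp [h2, h4]⟩
    simp only [add_mul, Finset.sum_add_distrib, ← h1, ← h3, map_add, TensorProduct.add_tmul,
      TensorProduct.tmul_add]
    abel
  | mul_X p k hp =>
    obtain ⟨D, h1, h2⟩ := hp
    refine ⟨fun j => D j * (φ (X k) ⊗ₜ[K] (1 : A)) + if j = k then (1 : A) ⊗ₜ[K] φ p else 0,
      ?_, fun j => ?_⟩
    · simp only [add_mul, Finset.sum_add_distrib, ite_mul, zero_mul, Finset.sum_ite_eq',
        Finset.mem_univ, if_true]
      have : ∑ j, D j * (φ (X k) ⊗ₜ[K] (1 : A)) *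
          (φ (X j) ⊗ₜ[K] (1 : A) - (1 : A) ⊗ₜ[K] φ (X j)) =
          (φ p ⊗ₜ[K] (1 : A) - (1 : A) ⊗ₜ[K] φ p) * (φ (X k) ⊗ₜ[K] (1 : A)) := by
        rw [h1, Finset.sum_mul]
        exact Finset.sum_congr rfl fun j _ => by ring
      rw [this]
      simp [sub_mul, mul_sub]
    · by_cases hjk : j = k
      · subst hjk
        simp [h2, mul_comm, add_comm]
      · simp [h2, hjk, mul_comm, pderiv_X, Ne.symm hjk]

open scoped TensorProduct in
lemma jac_bezout {K A : Type*} [Field K] [CommRing A] [Algebra K A] {n : ℕ}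
    (φ : MvPolynomial (Fin n) K →ₐ[K] A) (hφ : Function.Surjective φ)
    (g : Fin n → MvPolynomial (Fin n) K) (hg : ∀ i, φ (g i) = 0) :
    ∃ D : A ⊗[K] A, (∀ a : A, (a ⊗ₜ[K] (1 : A)) * D = ((1 : A) ⊗ₜ[K] a) * D) ∧
      Algebra.TensorProduct.lmul' K (S := A) D =
        φ (Matrix.det (Matrix.of fun i j : Fin n => pderiv j (g i))) := by
  choose D h1 h2 using fun i => jac_diff_lemma φ (g i)
  set v : Fin n → A ⊗[K] A := fun j => φ (X j) ⊗ₜ[K] (1 : A) - (1 : A) ⊗ₜ[K] φ (X j) with hv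
  have hD : (Matrix.of D).mulVec v = 0 := by
    ext i
    have := h1 i
    rw [hg] at this
    simp only [TensorProduct.zero_tmul, TensorProduct.tmul_zero, sub_zero] at this
    simpa [Matrix.mulVec, dotProduct] using this.symm
  have hdet : ∀ j, (Matrix.of D).det * v j = 0 := by
    have h3 : (Matrix.of D).adjugate.mulVec ((Matrix.of D).mulVec v) = 0 := by
      rw [hD, Matrix.mulVec_zero]
    rw [Matrix.mulVec_mulVec, Matrix.adjugate_mul, Matrix.smul_mulVec, Matrix.one_mulVec] at h3
    intro j
    simpa using congrFun h3 j
  refine ⟨(Matrix.of D).det, ?_, ?_⟩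
  · intro a
    obtain ⟨p, rfl⟩ := hφ a
    obtain ⟨E, h3, -⟩ := jac_diff_lemma φ p
    rw [← sub_eq_zero, ← sub_mul, h3, Finset.sum_mul]
    refine Finset.sum_eq_zero fun j _ => ?_
    rw [mul_assoc, mul_comm _ (Matrix.det _)]
    have := hdet j
    simp only [hv] at this
    rw [this, mul_zero]
  · rw [AlgHom.map_det, AlgHom.map_det]
    congr 1
    ext i j
    simp [h2]

lemma jac_trace_nilp {K A : Type*} [Field K] [CommRing A] [Algebra K A] [Module.Finite K A]
    (a : A) (ha : IsNilpotent a) : LinearMap.trace K A (LinearMap.mulLeft K a) = 0 := by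
  have h : IsNilpotent (LinearMap.mulLeft K a) := by
    obtain ⟨k, hk⟩ := ha
    exact ⟨k, by rw [LinearMap.pow_mulLeft, hk]; ext; simp⟩
  exact (LinearMap.isNilpotent_trace_of_isNilpotent h).eq_zero

lemma jac_socle {K : Type*} [Field K] {n : ℕ} (g : Fin n → MvPolynomial (Fin n) K)
    [Module.Finite K (MvPolynomial (Fin n) K ⧸ Ideal.span (Set.range g))]
    (m : Ideal (MvPolynomial (Fin n) K)) (N : ℕ)
    (hJ : Matrix.det (Matrix.of fun i j : Fin n => pderiv j (g i)) ∉
      Ideal.span (Set.range g) ⊔ m ^ N) :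
    ∃ u, u ∉ m ∧ ∀ x ∈ m ^ N, x * u ∈ Ideal.span (Set.range g) := by
  set I := Ideal.span (Set.range g) with hI
  set J := Matrix.det (Matrix.of fun i j : Fin n => pderiv j (g i)) with hJd
  let φ := Ideal.Quotient.mkₐ K I
  have hφ : Function.Surjective φ := Ideal.Quotient.mkₐ_surjective K I
  obtain ⟨D, hD1, hD2⟩ := jac_bezout φ hφ g (fun i => by
    simp only [φ, Ideal.Quotient.mkₐ_eq_mk]
    exact Ideal.Quotient.eq_zero_iff_mem.2 (Ideal.subset_span ⟨i, rfl⟩))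
  let L : Submodule K (MvPolynomial (Fin n) K ⧸ I) :=
    ((m ^ N).map (Ideal.Quotient.mk I)).restrictScalars K
  have hJL : φ J ∉ L := by
    intro h
    have h' : Ideal.Quotient.mk I J ∈ (m ^ N).map (Ideal.Quotient.mk I) := h
    rw [Ideal.mem_quotient_iff_mem_sup, sup_comm] at h'
    exact hJ h'
  obtain ⟨f, hf1, hf2⟩ := Submodule.exists_le_ker_of_notMem hJL
  obtain ⟨u, hu1, hu2⟩ := jac_trace_lemma D hD1 f
  rw [hD2] at hu1
  obtain ⟨w, rfl⟩ := hφ u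
  have hx : ∀ x ∈ m ^ N, x * w ∈ I := by
    intro x hx
    have := hu2 (φ x) (fun a => hf2 (show φ x * a ∈ (m ^ N).map (Ideal.Quotient.mk I) from
      Ideal.mul_mem_right _ _ (Ideal.mem_map_of_mem _ hx)))
    rw [← map_mul] at this
    exact Ideal.Quotient.eq_zero_iff_mem.1 this
  refine ⟨w, fun hw => ?_, hx⟩
  have hnil : IsNilpotent (φ w) := ⟨N + 1, by
    rw [← map_pow, pow_succ]
    exact Ideal.Quotient.eq_zero_iff_mem.2 (hx _ (Ideal.pow_mem_pow hw N))⟩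
  exact hf1 (hu1.symm.trans (jac_trace_nilp _ hnil))


lemma jac_finite_aux {K A : Type*} [Field K] [CommRing A] [Algebra K A] {n : ℕ}
    (φ : MvPolynomial (Fin n) K →ₐ[K] A) (hφ : Function.Surjective φ)
    (g : Fin n → MvPolynomial (Fin n) K) (M : ℕ)
    (hg : ∀ i, (g i - X i ^ M).totalDegree < M) (hg0 : ∀ i, φ (g i) = 0) :
    Module.Finite K A := by
  let S : Set A := Set.range fun e : Fin n → Fin M =>
    φ (monomial (Finsupp.equivFunOnFinite.symm fun i => (e i : ℕ)) 1)
  have key : ∀ d : ℕ, ∀ p : MvPolynomial (Fin n) K, p.totalDegree < d →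
      φ p ∈ Submodule.span K S := by
    intro d
    induction d with
    | zero => intro p hp; omega
    | succ d ih =>
      intro p hp
      rw [p.as_sum, map_sum]
      refine Submodule.sum_mem _ fun e he => ?_
      have hed : e.degree ≤ d := by
        have := le_totalDegree he
        have h2 : e.degree = e.sum fun _ k => k := rfl
        omega
      have : monomial e (coeff e p) = coeff e p • (monomial e (1 : K)) := by
        rw [smul_monomial, smul_eq_mul, mul_one]
      rw [this, map_smul]
      refine Submodule.smul_mem _ _ ?_
      by_cases hM : ∀ i, e i < M
      · refine Submodule.subset_span ⟨fun i => ⟨e i, hM i⟩, ?_⟩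
        have he' : (Finsupp.equivFunOnFinite.symm fun i => e i) = e := by ext; simp
        simp only [he']
      · push Not at hM
        obtain ⟨i, hi⟩ := hM
        have hle : Finsupp.single i M ≤ e := by simpa using hi
        have h1 : monomial e (1 : K) = monomial (e - Finsupp.single i M) 1 * X i ^ M := by
          rw [X_pow_eq_monomial, monomial_mul, mul_one, tsub_add_cancel_of_le hle]
        have h2 : φ (monomial e (1 : K)) =
            φ (- (monomial (e - Finsupp.single i M) 1 * (g i - X i ^ M))) := by
          rw [h1, map_neg, map_mul, map_mul, map_sub, hg0]
          ring
        rw [h2]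
        apply ih
        rw [totalDegree_neg]
        refine lt_of_le_of_lt (totalDegree_mul _ _) ?_
        have h4 : (monomial (e - Finsupp.single i M) (1 : K)).totalDegree =
            (e - Finsupp.single i M).degree := totalDegree_monomial _ one_ne_zero
        have h5 : (e - Finsupp.single i M).degree + M = e.degree := by
          conv_rhs => rw [← tsub_add_cancel_of_le hle]
          rw [map_add, Finsupp.degree_single]
        have := hg i
        omega
  have hS : S.Finite := Set.finite_range _
  refine ⟨⟨hS.toFinset, ?_⟩⟩
  rw [Set.Finite.coe_toFinset, eq_top_iff]
  rintro x -
  obtain ⟨p, rfl⟩ := hφ x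
  exact key _ p (Nat.lt_succ_self _)

lemma jac_finite {K : Type*} [Field K] {n : ℕ} (g : Fin n → MvPolynomial (Fin n) K) (M : ℕ)
    (hg : ∀ i, (g i - X i ^ M).totalDegree < M) :
    Module.Finite K (MvPolynomial (Fin n) K ⧸ Ideal.span (Set.range g)) :=
  jac_finite_aux (Ideal.Quotient.mkₐ K _) (Ideal.Quotient.mkₐ_surjective K _) g M hg
    fun i => Ideal.Quotient.eq_zero_iff_mem.2 (Ideal.subset_span ⟨i, rfl⟩)

lemma jac_perturb {K : Type*} [Field K] {n : ℕ} (P : Fin n → MvPolynomial (Fin n) K)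
    (a : Fin n → K) (N : ℕ) :
    ∃ g : Fin n → MvPolynomial (Fin n) K,
      Module.Finite K (MvPolynomial (Fin n) K ⧸ Ideal.span (Set.range g)) ∧
      Ideal.span (Set.range g) ≤ Ideal.span (Set.range P) ⊔ RingHom.ker (eval a) ^ (N + 1) ∧
      Matrix.det (Matrix.of fun i j : Fin n => pderiv j (P i)) -
      Matrix.det (Matrix.of fun i j : Fin n => pderiv j (g i)) ∈ RingHom.ker (eval a) ^ N := by
  set m := RingHom.ker (eval a) with hm
  have hX : ∀ i, X i - C (a i) ∈ m := fun i => by simp [hm, RingHom.mem_ker]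
  let M := (∑ i, (P i).totalDegree) + N + 1
  have hPM : ∀ i, (P i).totalDegree < M := fun i => by
    have := Finset.single_le_sum (f := fun i => (P i).totalDegree) (fun _ _ => Nat.zero_le _)
      (Finset.mem_univ i)
    omega
  refine ⟨fun i => P i + (X i - C (a i)) ^ M, jac_finite _ M ?_, ?_, ?_⟩
  · intro i
    have h1 : ∀ k : ℕ, ((X i - C (a i)) ^ (k + 1) - X i ^ (k + 1) :
        MvPolynomial (Fin n) K).totalDegree < k + 1 := by
      intro k
      induction k with
      | zero => simp
      | succ k ih =>
        have : ((X i - C (a i)) ^ (k + 1 + 1) - X i ^ (k + 1 + 1) : MvPolynomial (Fin n) K) =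
          ((X i - C (a i)) ^ (k + 1) - X i ^ (k + 1)) * (X i - C (a i)) - C (a i) * X i ^ (k + 1) := by
          ring
        rw [this]
        have h2 := totalDegree_sub
          (((X i - C (a i)) ^ (k + 1) - X i ^ (k + 1)) * (X i - C (a i)) : MvPolynomial (Fin n) K)
          (C (a i) * X i ^ (k + 1))
        have h3 := totalDegree_mul
          ((X i - C (a i)) ^ (k + 1) - X i ^ (k + 1) : MvPolynomial (Fin n) K) (X i - C (a i))
        have h4 := totalDegree_sub_C_le (X i : MvPolynomial (Fin n) K) (a i)
        have h5 := totalDegree_mul (C (a i)) (X i ^ (k + 1) : MvPolynomial (Fin n) K)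
        have h6 := totalDegree_X_pow (R := K) i (k + 1)
        have h7 := totalDegree_X (R := K) i
        have h8 := totalDegree_C (σ := Fin n) (a i)
        omega
    have h2 : (P i + (X i - C (a i)) ^ M - X i ^ M) = P i + ((X i - C (a i)) ^ M - X i ^ M) := by
      ring
    rw [h2]
    exact lt_of_le_of_lt (totalDegree_add _ _) (max_lt (hPM i) (h1 _))
  · rw [Ideal.span_le]
    rintro _ ⟨i, rfl⟩
    refine Ideal.add_mem _ (Ideal.mem_sup_left (Ideal.subset_span ⟨i, rfl⟩))
      (Ideal.mem_sup_right ?_)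
    exact Ideal.pow_le_pow_right (show N + 1 ≤ M by omega) (Ideal.pow_mem_pow (hX i) M)
  · rw [← Ideal.Quotient.eq, RingHom.map_det, RingHom.map_det]
    congr 1
    ext i j
    simp only [RingHom.mapMatrix_apply, Matrix.map_apply, Matrix.of_apply]
    rw [eq_comm, Ideal.Quotient.eq, map_add, add_sub_cancel_left, Derivation.leibniz_pow]
    rw [nsmul_eq_mul, smul_eq_mul]
    refine Ideal.mul_mem_left _ _ (Ideal.mul_mem_right _ _ ?_)
    exact Ideal.pow_le_pow_right (show N ≤ M - 1 by omega) (Ideal.pow_mem_pow (hX i) _)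

lemma jac_height (n : ℕ) (a : Fin n → ℂ) : (RingHom.ker (eval a)).height = n := by
  have hd : ringKrullDim (MvPolynomial (Fin n) ℂ) = n := by
    rw [MvPolynomial.ringKrullDim_of_isNoetherianRing]
    simp
  have : FiniteRingKrullDim (MvPolynomial (Fin n) ℂ) := by
    rw [finiteRingKrullDim_iff_ne_bot_and_top, hd]
    constructor
    · exact WithBot.coe_ne_bot
    · exact WithBot.coe_injective.ne (ENat.natCast_ne_top n)
  obtain ⟨p, hp, hh⟩ := Ideal.exists_isMaximal_height (R := MvPolynomial (Fin n) ℂ)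
  obtain ⟨b, rfl⟩ := (isMaximal_iff_eq_vanishingIdeal_singleton).1 hp
  let T : (Fin n → ℂ) → MvPolynomial (Fin n) ℂ →ₐ[ℂ] MvPolynomial (Fin n) ℂ :=
    fun c => aeval fun i => X i + C (c i)
  have hT : ∀ c d, c + d = 0 → (T c).comp (T d) = AlgHom.id _ _ := by
    intro c d h
    ext1 i
    have : c i + d i = 0 := congrFun h i
    simp [T, algHom_C, add_assoc, ← C_add, this]
  let e : MvPolynomial (Fin n) ℂ ≃ₐ[ℂ] MvPolynomial (Fin n) ℂ :=
    AlgEquiv.ofAlgHom (T (a - b)) (T (b - a)) (hT _ _ (by simp)) (hT _ _ (by simp))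
  have h1 : (vanishingIdeal ℂ {b}).comap e.toRingEquiv = RingHom.ker (eval a) := by
    ext q
    rw [Ideal.mem_comap, mem_vanishingIdeal_singleton_iff, RingHom.mem_ker]
    have : (aeval b).comp (T (a - b)) = aeval a := by
      ext i
      simp [T]
    have h2 := DFunLike.congr_fun this q
    change aeval b (T (a - b) q) = 0 ↔ _
    rw [← coe_aeval_eq_eval]
    change _ ↔ aeval a q = 0
    rw [← h2]
    rfl
  rw [← h1, RingEquiv.height_comap]
  rw [hd] at hh
  exact_mod_cast hh

lemma jac_krull {R : Type*} [CommRing R] [IsNoetherianRing R] (I m : Ideal R) (x : R)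
    (h : ∀ N, x ∈ I ⊔ m ^ N) : ∃ r ∈ m, (1 - r) * x ∈ I := by
  have h1 : Submodule.Quotient.mk (p := I) x ∈ (⨅ i : ℕ, m ^ i • ⊤ : Submodule R (R ⧸ I)) := by
    rw [Submodule.mem_iInf]
    intro N
    obtain ⟨y, hy, z, hz, rfl⟩ := Submodule.mem_sup.1 (h N)
    have : Submodule.Quotient.mk (p := I) (y + z) = z • Submodule.Quotient.mk (p := I) (1 : R) := by
      rw [← Submodule.Quotient.mk_smul, Submodule.Quotient.eq]
      simpa using hy
    rw [this]
    exact Submodule.smul_mem_smul hz trivial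
  obtain ⟨⟨r, hr⟩, h2⟩ := (m.mem_iInf_smul_pow_eq_bot_iff _).1 h1
  refine ⟨r, hr, ?_⟩
  rw [← Submodule.Quotient.mk_smul, eq_comm, Submodule.Quotient.eq] at h2
  simpa [sub_mul] using h2

/-- If the zero set of `P_1, …, P_n` in `ℂ^n` equals the zero set of the first `ν < n`
of them, then the Jacobian determinant lies in the ideal generated by `P_1, …, P_n`. -/
theorem jacobian_mem_ideal_of_zero_set_eq
    (n : ℕ) (hn : 0 < n) (P : Fin n → MvPolynomial (Fin n) ℂ)
    (ν : ℕ) (hν : 0 < ν) (hνn : ν < n)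
    (hzero : ∀ x : Fin n → ℂ,
      (∀ i : Fin n, (i : ℕ) < ν → eval x (P i) = 0) → ∀ i : Fin n, eval x (P i) = 0) :
    Matrix.det (Matrix.of fun i j : Fin n => pderiv j (P i)) ∈
      Ideal.span (Set.range P) := by
  set I := Ideal.span (Set.range P) with hI
  set J := Matrix.det (Matrix.of fun i j : Fin n => pderiv j (P i)) with hJ
  by_contra hJI
  let Q : Ideal (MvPolynomial (Fin n) ℂ) :=
    Submodule.comap (LinearMap.toSpanSingleton (MvPolynomial (Fin n) ℂ) _ J) I
  have hQ : ∀ r, r ∈ Q ↔ r * J ∈ I := fun r => by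
    simp [Q]
  have hQtop : Q ≠ ⊤ := by
    rw [Ne, Ideal.eq_top_iff_one, hQ, one_mul]
    exact hJI
  obtain ⟨m, hmax, hQm⟩ := Ideal.exists_le_maximal Q hQtop
  obtain ⟨a, ha⟩ := (isMaximal_iff_eq_vanishingIdeal_singleton (K := ℂ)).1 hmax
  have hma : m = RingHom.ker (eval a) := by
    ext q
    rw [ha, mem_vanishingIdeal_singleton_iff, RingHom.mem_ker, ← coe_aeval_eq_eval]
    rfl
  have hIm : I ≤ m := le_trans (fun x hx => (hQ x).2 (Ideal.mul_mem_right _ _ hx)) hQm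
  have h1m : (1 : MvPolynomial (Fin n) ℂ) ∉ m := fun h =>
    hmax.ne_top ((Ideal.eq_top_iff_one _).2 h)
  have hN : ∃ N, J ∉ I ⊔ m ^ N := by
    by_contra! hall
    obtain ⟨r, hr, hrJ⟩ := jac_krull I m J hall
    have h1 := hQm ((hQ _).2 hrJ)
    exact h1m (by simpa using m.add_mem h1 hr)
  obtain ⟨N, hN⟩ := hN
  obtain ⟨g, hfin, hgI, hgJ⟩ := jac_perturb P a N
  rw [← hma] at hgI hgJ
  have hgN : Ideal.span (Set.range g) ⊔ m ^ N ≤ I ⊔ m ^ N :=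
    sup_le (hgI.trans (sup_le_sup_left (Ideal.pow_le_pow_right (Nat.le_succ N)) _)) le_sup_right
  have hJg : Matrix.det (Matrix.of fun i j : Fin n => pderiv j (g i)) ∉
      Ideal.span (Set.range g) ⊔ m ^ N := by
    intro h
    apply hN
    have := (I ⊔ m ^ N).add_mem (Ideal.mem_sup_right hgJ) (hgN h)
    simpa using this
  obtain ⟨u, hum, hu⟩ := jac_socle g m N hJg
  have hu0 : eval a u ≠ 0 := fun h => hum (by rw [hma, RingHom.mem_ker]; exact h)
  have hle : m ^ N ≤ I ⊔ m • m ^ N := by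
    intro x hx
    have e1 : x = (1 - C (eval a u)⁻¹ * u) * x + C (eval a u)⁻¹ * (x * u) := by ring
    rw [e1, smul_eq_mul, ← pow_succ']
    refine Ideal.add_mem _ (Ideal.mem_sup_right ?_) (Ideal.mul_mem_left _ _ (hgI (hu x hx)))
    rw [pow_succ']
    refine Ideal.mul_mem_mul ?_ hx
    rw [hma, RingHom.mem_ker]
    simp [hu0]
  obtain ⟨r, hr1, hr⟩ := Submodule.exists_sub_one_mem_and_smul_le_of_fg_of_le_sup
    (IsNoetherian.noetherian (m ^ N)) le_rfl hle
  have hrm : r ∉ m := fun h => h1m (by simpa using m.sub_mem h hr1)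
  set s : Set (MvPolynomial (Fin n) ℂ) := P '' {i | (i : ℕ) < ν} with hs
  have hsfin : s.Finite := Set.toFinite _
  have hsI : Ideal.span s ≤ I := Ideal.span_mono (Set.image_subset_range _ _)
  have hrad : I ≤ (Ideal.span s).radical := by
    rw [← vanishingIdeal_zeroLocus_eq_radical (K := ℂ), hI, Ideal.span_le]
    rintro _ ⟨i, rfl⟩
    rw [SetLike.mem_coe, mem_vanishingIdeal_iff]
    intro x hx
    rw [mem_zeroLocus_iff] at hx
    change eval x (P i) = 0
    refine hzero x (fun j hj => ?_) i
    exact hx (P j) (Ideal.subset_span ⟨j, hj, rfl⟩)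
  have hmin : m ∈ (Ideal.span s).minimalPrimes := by
    refine ⟨⟨hmax.isPrime, hsI.trans hIm⟩, ?_⟩
    rintro q ⟨hq, hsq⟩ hqm
    have hIq : I ≤ q := hrad.trans (hq.radical_le_iff.2 hsq)
    refine hq.le_of_pow_le (n := N) fun x hx => ?_
    have hrx : r * x ∈ q := hIq (hr (Submodule.smul_mem_pointwise_smul x r _ hx))
    exact (hq.mem_or_mem hrx).resolve_left fun h => hrm (hqm h)
  have hht := Ideal.height_le_card_of_mem_minimalPrimes_span hsfin hmin
  rw [hma, jac_height] at hht
  have hcard : s.ncard ≤ ν := by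
    refine (Set.ncard_image_le (Set.toFinite _)).trans ?_
    have : ((fun i : Fin n => (i : ℕ)) '' {i | (i : ℕ) < ν}) ⊆ (Finset.range ν : Set ℕ) := by
      rintro _ ⟨i, hi, rfl⟩
      simpa using hi
    rw [← Set.ncard_image_of_injective _ Fin.val_injective]
    refine (Set.ncard_le_ncard this (Finset.finite_toSet _)).trans ?_
    rw [Set.ncard_coe_finset, Finset.card_range]
  have : n ≤ s.ncard := by exact_mod_cast hht
  omega
end

section
/- Let n be a positive integer, U an open neighborhood of 0 in ℂ^n, and f_1, …, f_n holomorphic functions on U. Let ν be a positive integer with ν < n, and assume that, after possibly shrinking U to a smaller neighborhood of 0, the common zero set V(f_1, …, f_n) coincides with the common zero set V(f_1, …, f_ν). Then the Jacobian J(f_1, …, f_n) belongs to the ideal (f_1, …, f_n) locally at 0: there exist an open neighborhood Ũ ⊆ U of 0 and holomorphic functions a_1, …, a_n on Ũ such that J(f_1, …, f_n) = a_1 f_1 + ⋯ + a_n f_n on Ũ. -/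
namespace JacAux
open MvPolynomial

/-- Polynomials all of whose monomials have degree `< d`. -/
noncomputable def Wd (σ : Type) (d : ℕ) : Submodule ℂ (MvPolynomial σ ℂ) :=
  MvPolynomial.restrictSupport ℂ {γ : σ →₀ ℕ | γ.degree < d}

lemma mem_Wd {σ : Type} {d : ℕ} {p : MvPolynomial σ ℂ} :
    p ∈ Wd σ d ↔ ∀ γ ∈ p.support, γ.degree < d := by
  unfold Wd
  rw [mem_restrictSupport_iff]
  exact Iff.rfl

lemma Wd_mono {σ : Type} {d e : ℕ} (h : d ≤ e) : Wd σ d ≤ Wd σ e := by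
  intro p hp
  rw [mem_Wd] at *
  intro γ hγ
  exact lt_of_lt_of_le (hp γ hγ) h

lemma monomial_mem_Wd {σ : Type} {d : ℕ} {γ : σ →₀ ℕ} (h : γ.degree < d) (c : ℂ) :
    monomial γ c ∈ Wd σ d := by
  unfold Wd
  rw [monomial_mem_restrictSupport]
  exact Or.inl h

lemma Wd_span {σ : Type} {d : ℕ} :
    Wd σ d = Submodule.span ℂ ((fun γ => monomial γ (1:ℂ)) '' {γ : σ →₀ ℕ | γ.degree < d}) :=
  restrictSupport_eq_span _ _

lemma Wd_zero {σ : Type} {p : MvPolynomial σ ℂ} (h : p ∈ Wd σ 0) : p = 0 := by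
  rw [mem_Wd] at h
  rw [← support_eq_empty]
  by_contra hne
  obtain ⟨γ, hγ⟩ := Finset.nonempty_iff_ne_empty.mpr hne
  exact absurd (h γ hγ) (by simp)

lemma exists_mem_Wd {σ : Type} (p : MvPolynomial σ ℂ) : ∃ d, p ∈ Wd σ d := by
  refine ⟨p.support.sup (fun γ => γ.degree) + 1, ?_⟩
  rw [mem_Wd]
  intro γ hγ
  exact Nat.lt_succ_of_le (Finset.le_sup (f := fun γ : σ →₀ ℕ => γ.degree) hγ)

lemma mul_mem_Wd {σ : Type} {d e : ℕ} {p q : MvPolynomial σ ℂ} (hp : p ∈ Wd σ d)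
    (hq : q ∈ Wd σ (e+1)) : p * q ∈ Wd σ (d + e) := by
  classical
  rw [mem_Wd] at *
  intro γ hγ
  have := MvPolynomial.support_mul p q hγ
  obtain ⟨a, ha, b, hb, rfl⟩ := Finset.mem_add.mp this
  have h1 := hp a ha
  have h2 := hq b hb
  rw [map_add]
  omega

/-- `a` has leading part `b` (of degree `d`). -/
def Lead {σ : Type} (d : ℕ) (a b : MvPolynomial σ ℂ) : Prop :=
  b ∈ Wd σ (d+1) ∧ a - b ∈ Wd σ d

lemma Lead.mul {σ : Type} {d e : ℕ} {a b a' b' : MvPolynomial σ ℂ} (h : Lead d a b)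
    (h' : Lead e a' b') : Lead (d+e) (a*a') (b*b') := by
  refine ⟨?_, ?_⟩
  · have := mul_mem_Wd h.1 h'.1
    rwa [show d + 1 + e = d + e + 1 by ring] at this
  · have e1 : a*a' - b*b' = (a-b)*(a'-b') + (a-b)*b' + (a'-b')*b := by ring
    rw [e1]
    refine add_mem (add_mem ?_ ?_) ?_
    · exact mul_mem_Wd h.2 (Wd_mono (Nat.le_succ e) h'.2)
    · exact mul_mem_Wd h.2 h'.1
    · rw [add_comm]; exact mul_mem_Wd h'.2 h.1

lemma Lead.one {σ : Type} : Lead 0 (1 : MvPolynomial σ ℂ) 1 := by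
  refine ⟨?_, by simp⟩
  exact monomial_mem_Wd (by simp) 1

lemma Lead.pow {σ : Type} {d : ℕ} {a b : MvPolynomial σ ℂ} (h : Lead d a b) (k : ℕ) :
    Lead (k*d) (a^k) (b^k) := by
  induction k with
  | zero => simpa using Lead.one
  | succ k ih =>
    rw [pow_succ, pow_succ, add_mul, one_mul]
    exact ih.mul h

lemma Lead.prod {σ ι : Type} (s : Finset ι) {d : ι → ℕ} {a b : ι → MvPolynomial σ ℂ}
    (h : ∀ i ∈ s, Lead (d i) (a i) (b i)) :
    Lead (∑ i ∈ s, d i) (∏ i ∈ s, a i) (∏ i ∈ s, b i) := by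
  classical
  induction s using Finset.induction_on with
  | empty => simpa using Lead.one
  | insert i s hi ih =>
    rw [Finset.sum_insert hi, Finset.prod_insert hi, Finset.prod_insert hi]
    exact (h i (by simp)).mul (ih fun j hj => h j (by simp [hj]))

lemma Lead.X {σ : Type} (i : σ) : Lead 1 (X i : MvPolynomial σ ℂ) (X i) := by
  refine ⟨?_, by simp⟩
  exact monomial_mem_Wd (by simp) 1

section Tau

variable {n : ℕ} (L : ℕ) (P : Fin n → MvPolynomial (Fin n) ℂ)

/-- The polynomial system `P_i + X_i ^ L`. -/
noncomputable def FF (i : Fin n) : MvPolynomial (Fin n) ℂ := P i + X i ^ L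

/-- The triangular change of basis. -/
noncomputable def Phi : MvPolynomial (Fin n) ℂ →ₗ[ℂ] MvPolynomial (Fin n) ℂ :=
  (basisMonomials (Fin n) ℂ).constr ℂ (fun γ => ∏ i, (X i ^ (γ i % L) * FF L P i ^ (γ i / L)))

lemma Phi_monomial (γ : Fin n →₀ ℕ) :
    Phi L P (monomial γ 1) = ∏ i, (X i ^ (γ i % L) * FF L P i ^ (γ i / L)) := by
  unfold Phi
  have := (basisMonomials (Fin n) ℂ).constr_basis ℂ
    (fun γ : Fin n →₀ ℕ => ∏ i, (X i ^ (γ i % L) * FF L P i ^ (γ i / L))) γ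
  simpa using this

variable {L P}

lemma monomial_eq_prod (γ : Fin n →₀ ℕ) : monomial γ (1:ℂ) = ∏ i, X i ^ (γ i) := by
  rw [MvPolynomial.monomial_eq]
  simp [Finsupp.prod_fintype]

lemma Phi_lead (hP : ∀ i, P i ∈ Wd (Fin n) L) (γ : Fin n →₀ ℕ) :
    Lead γ.degree (Phi L P (monomial γ 1)) (monomial γ 1) := by
  have hF : ∀ i, Lead L (FF L P i) (X i ^ L) := by
    intro i
    refine ⟨?_, ?_⟩
    · have := ((Lead.X i).pow L).1
      simpa using this
    · simpa [FF] using hP i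
  have key := Lead.prod Finset.univ (d := γ) (a := fun i => X i ^ (γ i % L) * FF L P i ^ (γ i / L))
    (b := fun i => X i ^ (γ i)) (fun i _ => by
      have h1 := ((Lead.X i).pow (γ i % L)).mul ((hF i).pow (γ i / L))
      have e1 : γ i % L * 1 + γ i / L * L = γ i := by
        rw [mul_one]; exact Nat.mod_add_div' _ _
      rw [e1] at h1
      convert h1 using 1
      rw [← pow_mul, ← pow_add, Nat.mod_add_div])
  rw [Phi_monomial, monomial_eq_prod, Finsupp.degree_eq_sum]
  exact key

lemma Phi_sub_mem (hP : ∀ i, P i ∈ Wd (Fin n) L) {d : ℕ} {p : MvPolynomial (Fin n) ℂ}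
    (hp : p ∈ Wd (Fin n) (d+1)) : Phi L P p - p ∈ Wd (Fin n) d := by
  rw [Wd_span] at hp
  induction hp using Submodule.span_induction with
  | mem x hx =>
    obtain ⟨γ, hγ, rfl⟩ := hx
    exact Wd_mono (Nat.lt_succ_iff.mp hγ) (Phi_lead hP γ).2
  | zero => simp
  | add x y _ _ hx hy =>
    rw [map_add, add_sub_add_comm]; exact add_mem hx hy
  | smul a x _ hx =>
    rw [map_smul, ← smul_sub]; exact Submodule.smul_mem _ _ hx

lemma Phi_surj_deg (hP : ∀ i, P i ∈ Wd (Fin n) L) (d : ℕ) : ∀ p ∈ Wd (Fin n) d,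
    ∃ q ∈ Wd (Fin n) d, Phi L P q = p := by
  induction d with
  | zero =>
    intro p hp
    exact ⟨0, by simp, by simp [Wd_zero hp]⟩
  | succ d ih =>
    intro p hp
    obtain ⟨q, hq, hqe⟩ := ih _ (Phi_sub_mem hP hp)
    refine ⟨p - q, sub_mem hp (Wd_mono (Nat.le_succ d) hq), ?_⟩
    rw [map_sub, hqe]; ring

lemma Phi_inj (hP : ∀ i, P i ∈ Wd (Fin n) L) : Function.Injective (Phi L P) := by
  rw [injective_iff_map_eq_zero]
  intro p hp
  obtain ⟨d, hd⟩ := exists_mem_Wd p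
  induction d with
  | zero => exact Wd_zero hd
  | succ d ih =>
    apply ih
    have := Phi_sub_mem hP hd
    rw [hp, zero_sub] at this
    simpa using this

lemma Phi_bij (hP : ∀ i, P i ∈ Wd (Fin n) L) : Function.Bijective (Phi L P) := by
  refine ⟨Phi_inj hP, fun p => ?_⟩
  obtain ⟨d, hd⟩ := exists_mem_Wd p
  obtain ⟨q, _, hq⟩ := Phi_surj_deg hP d p hd
  exact ⟨q, hq⟩

lemma Phi_shift (hL : 0 < L) (i : Fin n) (γ : Fin n →₀ ℕ) :
    FF L P i * Phi L P (monomial γ 1) = Phi L P (monomial (γ + Finsupp.single i L) 1) := by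
  rw [Phi_monomial, Phi_monomial, ← Finset.mul_prod_erase _ _ (Finset.mem_univ i),
    ← Finset.mul_prod_erase Finset.univ (fun j => X j ^ ((γ + Finsupp.single i L) j % L) *
      FF L P j ^ ((γ + Finsupp.single i L) j / L)) (Finset.mem_univ i), ← mul_assoc]
  congr 1
  · simp [Nat.add_div_right _ hL]
    ring
  · apply Finset.prod_congr rfl
    intro j hj
    have : i ≠ j := fun h => by simp [h] at hj
    simp [this]

variable (n L) in
/-- Functional reading off the coefficients of shape `top + L q`, weighted by `w ^ q`. -/
noncomputable def theta (w : Fin n → ℂ) : MvPolynomial (Fin n) ℂ →ₗ[ℂ] ℂ :=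
  (basisMonomials (Fin n) ℂ).constr ℂ
    (fun γ => ∏ i, (if γ i % L = L - 1 then w i ^ (γ i / L) else 0))

lemma theta_monomial (w : Fin n → ℂ) (γ : Fin n →₀ ℕ) : theta n L w (monomial γ 1) =
    ∏ i, (if γ i % L = L - 1 then w i ^ (γ i / L) else 0) := by
  have := (basisMonomials (Fin n) ℂ).constr_basis ℂ
    (fun γ : Fin n →₀ ℕ => ∏ i, (if γ i % L = L - 1 then w i ^ (γ i / L) else 0)) γ
  simpa [theta] using this

lemma theta_shift (hL : 0 < L) (w : Fin n → ℂ) (i : Fin n) (γ : Fin n →₀ ℕ) :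
    theta n L w (monomial (γ + Finsupp.single i L) 1) = w i * theta n L w (monomial γ 1) := by
  rw [theta_monomial, theta_monomial, ← Finset.mul_prod_erase _ _ (Finset.mem_univ i),
    ← Finset.mul_prod_erase Finset.univ (fun j => if γ j % L = L - 1 then w j ^ (γ j / L) else 0)
      (Finset.mem_univ i), ← mul_assoc]
  congr 1
  · simp [Nat.add_div_right _ hL]
    split_ifs <;> ring
  · apply Finset.prod_congr rfl
    intro j hj
    have : i ≠ j := fun h => by simp [h] at hj
    simp [this]

lemma theta_low (w : Fin n → ℂ) {q : MvPolynomial (Fin n) ℂ}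
    (hq : q ∈ Wd (Fin n) (n * (L-1))) : theta n L w q = 0 := by
  rw [Wd_span] at hq
  induction hq using Submodule.span_induction with
  | mem x hx =>
    obtain ⟨γ, hγ, rfl⟩ := hx
    simp only [theta_monomial]
    by_contra hne
    rw [← ne_eq, Finset.prod_ne_zero_iff] at hne
    have h2 : ∀ i, L - 1 ≤ γ i := by
      intro i
      have := hne i (Finset.mem_univ i)
      have h3 : γ i % L = L - 1 := by
        by_contra h; simp [h] at this
      rw [← h3]; exact Nat.mod_le _ _
    have h4 : n * (L-1) ≤ γ.degree := by
      rw [Finsupp.degree_eq_sum]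
      calc n * (L-1) = ∑ i : Fin n, (L-1) := by simp
        _ ≤ _ := Finset.sum_le_sum fun i _ => h2 i
    have : γ.degree < n * (L-1) := hγ
    omega
  | zero => simp
  | add x y _ _ hx hy => rw [map_add, hx, hy, add_zero]
  | smul a x _ hx => rw [map_smul, hx, smul_zero]

lemma theta_top (hL : 0 < L) (w : Fin n → ℂ) {γ : Fin n →₀ ℕ} (hγ : γ.degree = n * (L-1)) :
    theta n L w (monomial γ 1) = if (∀ i, γ i = L - 1) then 1 else 0 := by
  rw [theta_monomial]
  split_ifs with h
  · apply Finset.prod_eq_one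
    intro i _
    rw [h i]
    have h1 : L - 1 < L := by omega
    simp [Nat.mod_eq_of_lt h1, Nat.div_eq_of_lt h1]
  · by_contra hne
    rw [← ne_eq, Finset.prod_ne_zero_iff] at hne
    have h2 : ∀ i, L - 1 ≤ γ i := by
      intro i
      have := hne i (Finset.mem_univ i)
      have h3 : γ i % L = L - 1 := by
        by_contra h; simp [h] at this
      rw [← h3]; exact Nat.mod_le _ _
    rw [Finsupp.degree_eq_sum] at hγ
    have h5 : ∑ i : Fin n, (L-1) = ∑ i, γ i := by rw [hγ]; simp
    rw [Finset.sum_eq_sum_iff_of_le (fun i _ => h2 i)] at h5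
    exact h fun i => (h5 i (Finset.mem_univ i)).symm

lemma theta_cont (q : MvPolynomial (Fin n) ℂ) : Continuous fun w => theta n L w q := by
  induction q using MvPolynomial.induction_on' with
  | monomial γ a =>
    have : ∀ w, theta n L w (monomial γ a) = a * theta n L w (monomial γ 1) := by
      intro w
      rw [← smul_eq_mul, ← map_smul, smul_monomial, smul_eq_mul, mul_one]
    simp only [this, theta_monomial]
    refine continuous_const.mul (continuous_finsetProd _ fun i _ => ?_)
    split_ifs
    · fun_prop
    · exact continuous_const
  | add p q hp hq => simp only [map_add]; exact hp.add hq

theorem exists_tau (hL : 0 < L) (hP : ∀ i, P i ∈ Wd (Fin n) L) :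
    ∃ τ : (Fin n → ℂ) → (MvPolynomial (Fin n) ℂ →ₗ[ℂ] ℂ),
      (∀ w i p, τ w ((FF L P i - C (w i)) * p) = 0) ∧
      (∀ w p, p ∈ Wd (Fin n) (n * (L-1)) → τ w p = 0) ∧
      (∀ w (γ : Fin n →₀ ℕ), γ.degree = n * (L-1) →
        τ w (monomial γ 1) = if (∀ i, γ i = L - 1) then 1 else 0) ∧
      ∀ p, Continuous fun w => τ w p := by
  obtain ⟨e, he, he'⟩ : ∃ e : MvPolynomial (Fin n) ℂ ≃ₗ[ℂ] MvPolynomial (Fin n) ℂ,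
      (∀ p, Phi L P (e.symm p) = p) ∧ (∀ p, e.symm (Phi L P p) = p) :=
    ⟨LinearEquiv.ofBijective (Phi L P) (Phi_bij hP),
      fun p => LinearEquiv.apply_symm_apply (LinearEquiv.ofBijective (Phi L P) (Phi_bij hP)) p,
      fun p => LinearEquiv.symm_apply_apply (LinearEquiv.ofBijective (Phi L P) (Phi_bij hP)) p⟩
  have hdeg : ∀ d, ∀ p ∈ Wd (Fin n) d, e.symm p ∈ Wd (Fin n) d := by
    intro d p hp
    obtain ⟨q, hq, rfl⟩ := Phi_surj_deg hP d p hp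
    rwa [he']
  refine ⟨fun w => (theta n L w) ∘ₗ e.symm.toLinearMap, ?_, ?_, ?_, ?_⟩
  · intro w i p
    obtain ⟨q, rfl⟩ := (Phi_bij hP).2 p
    simp only [LinearMap.comp_apply, LinearEquiv.coe_coe]
    induction q using MvPolynomial.induction_on' with
    | monomial γ a =>
      have e1 : monomial γ a = a • monomial γ (1:ℂ) := by simp [smul_monomial]
      rw [e1, map_smul, mul_smul_comm, map_smul, map_smul, sub_mul, Phi_shift hL, map_sub, he',
        C_mul', map_smul, he', map_sub, theta_shift hL, map_smul, smul_eq_mul (w i), sub_self, smul_zero]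
    | add p q hp hq =>
      rw [map_add, mul_add, map_add, map_add, hp, hq, add_zero]
  · intro w p hp
    have h := theta_low w (hdeg _ _ hp)
    simp only [LinearMap.comp_apply, LinearEquiv.coe_coe]
    exact h
  · intro w γ hγ
    have h1 : monomial γ (1:ℂ) ∈ Wd (Fin n) (n*(L-1)+1) := monomial_mem_Wd (by omega) 1
    have h2 := Phi_sub_mem hP (hdeg _ _ h1)
    rw [he] at h2
    have h3 := theta_low w h2
    rw [map_sub, sub_eq_zero] at h3
    simp only [LinearMap.comp_apply, LinearEquiv.coe_coe]
    rw [← h3, theta_top hL w hγ]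
  · intro p
    have h := theta_cont (L := L) (e.symm p)
    simp only [LinearMap.comp_apply, LinearEquiv.coe_coe]
    exact h

end Tau
end JacAux


namespace JacAux
open MvPolynomial

section Bez
variable {n : ℕ}

/-- Multiplication (diagonal) map. -/
noncomputable def diagMap (n : ℕ) : MvPolynomial (Fin n ⊕ Fin n) ℂ →ₐ[ℂ] MvPolynomial (Fin n) ℂ :=
  aeval (Sum.elim X X)

/-- first copy of the variables -/
noncomputable def zz (p : MvPolynomial (Fin n) ℂ) : MvPolynomial (Fin n ⊕ Fin n) ℂ :=
  rename Sum.inl p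
/-- second copy of the variables -/
noncomputable def yy (p : MvPolynomial (Fin n) ℂ) : MvPolynomial (Fin n ⊕ Fin n) ℂ :=
  rename Sum.inr p

lemma diag_zz (p : MvPolynomial (Fin n) ℂ) : diagMap n (zz p) = p := by
  unfold diagMap zz
  rw [aeval_rename]
  simp

lemma diag_yy (p : MvPolynomial (Fin n) ℂ) : diagMap n (yy p) = p := by
  unfold diagMap yy
  rw [aeval_rename]
  simp

lemma yy_mem {d : ℕ} {p : MvPolynomial (Fin n) ℂ} (hp : p ∈ Wd (Fin n) d) :
    yy p ∈ Wd (Fin n ⊕ Fin n) d := by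
  rw [Wd_span] at hp
  unfold yy
  induction hp using Submodule.span_induction with
  | mem x hx =>
    obtain ⟨γ, hγ, rfl⟩ := hx
    rw [rename_monomial]
    apply monomial_mem_Wd
    rw [Finsupp.degree_mapDomain]; exact hγ
  | zero => simp
  | add x y _ _ hx hy => rw [map_add]; exact add_mem hx hy
  | smul a x _ hx => rw [map_smul]; exact Submodule.smul_mem _ _ hx

/-- Bezout-type decomposition predicate. -/
def Good (d : ℕ) (p : MvPolynomial (Fin n) ℂ) : Prop :=
  ∃ A : Fin n → MvPolynomial (Fin n ⊕ Fin n) ℂ, (∀ j, A j ∈ Wd (Fin n ⊕ Fin n) d) ∧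
    zz p - yy p = ∑ j, A j * (X (Sum.inl j) - X (Sum.inr j)) ∧
    ∀ j, diagMap n (A j) = pderiv j p

lemma Good.mono {d e : ℕ} (h : d ≤ e) {p : MvPolynomial (Fin n) ℂ} (hp : Good d p) : Good e p := by
  obtain ⟨A, h1, h2⟩ := hp
  exact ⟨A, fun j => Wd_mono h (h1 j), h2⟩

lemma good_one : Good 0 (1 : MvPolynomial (Fin n) ℂ) :=
  ⟨0, by simp, by simp [zz, yy], by simp⟩

lemma good_mul_X {d : ℕ} {p : MvPolynomial (Fin n) ℂ} (hp : Good d p)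
    (hpd : p ∈ Wd (Fin n) (d+1)) (k : Fin n) : Good (d+1) (p * X k) := by
  classical
  obtain ⟨A, h1, h2, h3⟩ := hp
  refine ⟨fun j => A j * X (Sum.inl k) + if j = k then yy p else 0, ?_, ?_, ?_⟩
  · intro j
    refine add_mem (mul_mem_Wd (h1 j) (Lead.X _).1) ?_
    split_ifs
    · exact yy_mem hpd
    · simp
  · have e1 : zz (p * X k) - yy (p * X k) = (zz p - yy p) * X (Sum.inl k) +
        yy p * (X (Sum.inl k) - X (Sum.inr k)) := by
      simp only [zz, yy, map_mul, rename_X]; ring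
    rw [e1, h2, Finset.sum_mul]
    simp only [add_mul, Finset.sum_add_distrib, ite_mul, zero_mul, Finset.sum_ite_eq',
      Finset.mem_univ, if_true]
    have e3 : ∑ j, A j * (X (Sum.inl j) - X (Sum.inr j)) * X (Sum.inl k) =
        ∑ j, A j * X (Sum.inl k) * (X (Sum.inl j) - X (Sum.inr j)) :=
      Finset.sum_congr rfl fun j _ => mul_right_comm _ _ _
    rw [e3]
  · intro j
    rw [map_add, map_mul, h3]
    have e2 : diagMap n (X (Sum.inl k)) = X k := by simp [diagMap]
    rw [e2, Derivation.leibniz, pderiv_X, smul_eq_mul, smul_eq_mul, Pi.single_apply]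
    by_cases h : j = k
    · simp [h, diag_yy]; ring
    · rw [if_neg h, if_neg (Ne.symm h)]; simp; ring

lemma good_monomial (d : ℕ) : ∀ γ : Fin n →₀ ℕ, γ.degree = d → Good d (monomial γ (1:ℂ)) := by
  induction d with
  | zero =>
    intro γ hγ
    rw [Finsupp.degree_eq_zero_iff] at hγ
    subst hγ
    exact good_one
  | succ d ih =>
    intro γ hγ
    have hne : γ ≠ 0 := by
      rintro rfl; simp at hγ
    obtain ⟨k, hk⟩ := Finsupp.support_nonempty_iff.mpr hne
    have hk' : Finsupp.single k 1 ≤ γ := by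
      rw [Finsupp.single_le_iff]
      exact Nat.one_le_iff_ne_zero.mpr (Finsupp.mem_support_iff.mp hk)
    obtain ⟨γ', rfl⟩ := exists_add_of_le hk'
    rw [map_add, Finsupp.degree_single] at hγ
    have hd : γ'.degree = d := by omega
    have := good_mul_X (ih γ' hd) (monomial_mem_Wd (by omega) 1) k
    rw [X, monomial_mul, mul_one] at this
    rw [add_comm (Finsupp.single k 1)]
    exact this

lemma good_of_mem {d : ℕ} {p : MvPolynomial (Fin n) ℂ} (hp : p ∈ Wd (Fin n) (d+1)) : Good d p := by
  rw [Wd_span] at hp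
  induction hp using Submodule.span_induction with
  | mem x hx =>
    obtain ⟨γ, hγ, rfl⟩ := hx
    exact (good_monomial _ γ rfl).mono (Nat.lt_succ_iff.mp hγ)
  | zero => exact ⟨0, by simp, by simp [zz, yy], by simp⟩
  | add x y _ _ hx hy =>
    obtain ⟨A, a1, a2, a3⟩ := hx
    obtain ⟨B, b1, b2, b3⟩ := hy
    refine ⟨A + B, fun j => add_mem (a1 j) (b1 j), ?_, ?_⟩
    · simp only [zz, yy] at *
      rw [map_add, map_add, add_sub_add_comm, a2, b2, ← Finset.sum_add_distrib]
      exact Finset.sum_congr rfl fun j _ => by simp only [Pi.add_apply]; ring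
    · intro j; rw [Pi.add_apply, map_add, map_add, a3, b3]
  | smul a x _ hx =>
    obtain ⟨A, a1, a2, a3⟩ := hx
    refine ⟨a • A, fun j => Submodule.smul_mem _ _ (a1 j), ?_, ?_⟩
    · simp only [zz, yy] at *
      rw [map_smul, map_smul, ← smul_sub, a2, Finset.smul_sum]
      exact Finset.sum_congr rfl fun j _ => by simp only [Pi.smul_apply]; rw [smul_mul_assoc]
    · intro j; rw [Pi.smul_apply, map_smul, a3, Derivation.map_smul]

/-- partial functional -/
noncomputable def tau1 (τ : MvPolynomial (Fin n) ℂ →ₗ[ℂ] ℂ) :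
    MvPolynomial (Fin n ⊕ Fin n) ℂ →ₗ[ℂ] MvPolynomial (Fin n) ℂ :=
  (basisMonomials (Fin n ⊕ Fin n) ℂ).constr ℂ (fun s =>
    τ (monomial (s.comapDomain Sum.inl Sum.inl_injective.injOn) 1) •
      monomial (s.comapDomain Sum.inr Sum.inr_injective.injOn) 1)

lemma tau1_monomial (τ : MvPolynomial (Fin n) ℂ →ₗ[ℂ] ℂ) (s : (Fin n ⊕ Fin n) →₀ ℕ) :
    tau1 τ (monomial s 1) = τ (monomial (s.comapDomain Sum.inl Sum.inl_injective.injOn) 1) •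
      monomial (s.comapDomain Sum.inr Sum.inr_injective.injOn) 1 := by
  have := (basisMonomials (Fin n ⊕ Fin n) ℂ).constr_basis ℂ (fun s =>
    τ (monomial (s.comapDomain Sum.inl Sum.inl_injective.injOn) 1) •
      monomial (s.comapDomain Sum.inr Sum.inr_injective.injOn) (1:ℂ)) s
  simpa [tau1] using this

lemma monomial_split (s : (Fin n ⊕ Fin n) →₀ ℕ) : monomial s (1:ℂ) =
    zz (monomial (s.comapDomain Sum.inl Sum.inl_injective.injOn) 1) *
    yy (monomial (s.comapDomain Sum.inr Sum.inr_injective.injOn) 1) := by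
  unfold zz yy
  rw [rename_monomial, rename_monomial, monomial_mul, mul_one]
  refine congrArg (fun t => monomial t (1:ℂ)) ?_
  refine Finsupp.ext fun i => ?_
  rcases i with i | i
  · rw [Finsupp.add_apply, Finsupp.mapDomain_apply Sum.inl_injective,
      Finsupp.mapDomain_of_notMem_range _ _ (by simp)]
    simp
  · rw [Finsupp.add_apply, Finsupp.mapDomain_apply Sum.inr_injective,
      Finsupp.mapDomain_of_notMem_range _ _ (by simp)]
    simp

lemma tau1_zz_yy (τ : MvPolynomial (Fin n) ℂ →ₗ[ℂ] ℂ) (p q : MvPolynomial (Fin n) ℂ) :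
    tau1 τ (zz p * yy q) = τ p • q := by
  induction p using MvPolynomial.induction_on' with
  | add p p' hp hp' =>
    have : zz (p + p') = zz p + zz p' := by simp [zz]
    rw [this, add_mul, map_add, map_add, add_smul, hp, hp']
  | monomial α a =>
    induction q using MvPolynomial.induction_on' with
    | add p p' hp hp' =>
      have : yy (p + p') = yy p + yy p' := by simp [yy]
      rw [this, mul_add, map_add, smul_add, hp, hp']
    | monomial β b =>
      have e1 : monomial α a = a • monomial α (1:ℂ) := by simp [smul_monomial]
      have e2 : monomial β b = b • monomial β (1:ℂ) := by simp [smul_monomial]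
      have e3 : zz (a • monomial α (1:ℂ)) * yy (b • monomial β (1:ℂ)) =
          (a * b) • (zz (monomial α (1:ℂ)) * yy (monomial β (1:ℂ))) := by
        simp only [zz, yy, map_smul]
        rw [smul_mul_smul_comm]
      rw [e1, e2, e3, map_smul, map_smul]
      unfold zz yy
      rw [rename_monomial, rename_monomial, monomial_mul, mul_one, tau1_monomial]
      have f1 : (Finsupp.mapDomain Sum.inl α + Finsupp.mapDomain Sum.inr β :
        (Fin n ⊕ Fin n) →₀ ℕ).comapDomain Sum.inl Sum.inl_injective.injOn = α := by
        ext i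
        rw [Finsupp.comapDomain_apply, Finsupp.add_apply,
          Finsupp.mapDomain_apply Sum.inl_injective, Finsupp.mapDomain_of_notMem_range _ _ (by simp)]
        simp
      have f2 : (Finsupp.mapDomain Sum.inl α + Finsupp.mapDomain Sum.inr β :
        (Fin n ⊕ Fin n) →₀ ℕ).comapDomain Sum.inr Sum.inr_injective.injOn = β := by
        ext i
        rw [Finsupp.comapDomain_apply, Finsupp.add_apply,
          Finsupp.mapDomain_apply Sum.inr_injective, Finsupp.mapDomain_of_notMem_range _ _ (by simp)]
        simp
      rw [f1, f2, smul_eq_mul]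
      simp only [smul_smul]
      congr 1; ring

lemma induct_zy {motive : MvPolynomial (Fin n ⊕ Fin n) ℂ → Prop}
    (h1 : ∀ p q, motive (zz p * yy q)) (h2 : ∀ a b, motive a → motive b → motive (a+b))
    (G : MvPolynomial (Fin n ⊕ Fin n) ℂ) : motive G := by
  induction G using MvPolynomial.induction_on' with
  | add p q hp hq => exact h2 _ _ hp hq
  | monomial s a =>
    have e1 : monomial s a = a • monomial s (1:ℂ) := by simp [smul_monomial]
    rw [e1, monomial_split, ← smul_mul_assoc]
    have : ∀ p : MvPolynomial (Fin n) ℂ, a • zz p = zz (a • p) := by intro p; simp [zz]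
    rw [this]
    exact h1 _ _

lemma tau1_yy_mul (τ : MvPolynomial (Fin n) ℂ →ₗ[ℂ] ℂ) (p : MvPolynomial (Fin n) ℂ)
    (G : MvPolynomial (Fin n ⊕ Fin n) ℂ) : tau1 τ (yy p * G) = p * tau1 τ G := by
  induction G using induct_zy with
  | h1 a b =>
    have : yy p * (zz a * yy b) = zz a * yy (p * b) := by simp [zz, yy]; ring
    rw [this, tau1_zz_yy, tau1_zz_yy, mul_smul_comm]
  | h2 a b ha hb => rw [mul_add, map_add, map_add, ha, hb, mul_add]

lemma tau1_zz_mul (τ : MvPolynomial (Fin n) ℂ →ₗ[ℂ] ℂ) (p : MvPolynomial (Fin n) ℂ)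
    (hp : ∀ q, τ (p * q) = 0)
    (G : MvPolynomial (Fin n ⊕ Fin n) ℂ) : tau1 τ (zz p * G) = 0 := by
  induction G using induct_zy with
  | h1 a b =>
    have : zz p * (zz a * yy b) = zz (p * a) * yy b := by simp [zz]; ring
    rw [this, tau1_zz_yy, hp, zero_smul]
  | h2 a b ha hb => rw [mul_add, map_add, ha, hb, add_zero]

lemma tau1_low (τ : MvPolynomial (Fin n) ℂ →ₗ[ℂ] ℂ) (N : ℕ)
    (hτ : ∀ p ∈ Wd (Fin n) N, τ p = 0) (G : MvPolynomial (Fin n ⊕ Fin n) ℂ)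
    (hG : G ∈ Wd (Fin n ⊕ Fin n) N) : tau1 τ G = 0 := by
  rw [Wd_span] at hG
  induction hG using Submodule.span_induction with
  | mem x hx =>
    obtain ⟨γ, hγ, rfl⟩ := hx
    simp only [tau1_monomial]
    rw [hτ, zero_smul]
    apply monomial_mem_Wd
    exact lt_of_le_of_lt (Finsupp.degree_comapDomain_le_of_canonicallyOrderedAdd _) hγ
  | zero => simp
  | add x y _ _ hx hy => rw [map_add, hx, hy, add_zero]
  | smul a x _ hx => rw [map_smul, hx, smul_zero]

/-- The quotient polynomial `(z_i^L - y_i^L)/(z_i - y_i)`. -/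
noncomputable def hh (L : ℕ) (i : Fin n) : MvPolynomial (Fin n ⊕ Fin n) ℂ :=
  ∑ a ∈ Finset.range L, X (Sum.inl i) ^ a * X (Sum.inr i) ^ (L - 1 - a)

lemma hh_mem {L : ℕ} (hL : 0 < L) (i : Fin n) : hh L i ∈ Wd (Fin n ⊕ Fin n) (L - 1 + 1) := by
  refine sum_mem fun a ha => ?_
  have ha' := Finset.mem_range.mp ha
  have := (((Lead.X (Sum.inl i : Fin n ⊕ Fin n)).pow a).mul
    ((Lead.X (Sum.inr i : Fin n ⊕ Fin n)).pow (L-1-a))).1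
  rwa [show a * 1 + (L - 1 - a) * 1 = L - 1 by omega] at this

lemma tau1_prod_hh {L : ℕ} (hL : 0 < L) (τ : MvPolynomial (Fin n) ℂ →ₗ[ℂ] ℂ)
    (h1 : ∀ p, p ∈ Wd (Fin n) (n * (L-1)) → τ p = 0)
    (h2 : ∀ (γ : Fin n →₀ ℕ), γ.degree = n * (L-1) →
        τ (monomial γ 1) = if (∀ i, γ i = L - 1) then 1 else 0) :
    tau1 τ (∏ i, hh L i) = 1 := by
  classical
  unfold hh
  rw [Finset.prod_univ_sum, map_sum]
  have key : ∀ a ∈ Fintype.piFinset (fun _ : Fin n => Finset.range L),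
      tau1 τ (∏ i, (X (Sum.inl i) ^ a i * X (Sum.inr i) ^ (L - 1 - a i))) =
      if a = fun _ => L - 1 then 1 else 0 := by
    intro a ha
    rw [Fintype.mem_piFinset] at ha
    have ha' : ∀ i, a i ≤ L - 1 := fun i => by
      have := Finset.mem_range.mp (ha i); omega
    have e1 : (∏ i, (X (Sum.inl i) ^ a i * X (Sum.inr i) ^ (L - 1 - a i)) :
        MvPolynomial (Fin n ⊕ Fin n) ℂ) = zz (∏ i, X i ^ a i) * yy (∏ i, X i ^ (L-1-a i)) := by
      simp [zz, yy, Finset.prod_mul_distrib]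
    have e2 : (∏ i, X i ^ a i : MvPolynomial (Fin n) ℂ) =
        monomial (Finsupp.equivFunOnFinite.symm a) 1 := by
      rw [monomial_eq_prod]; simp
    have e3 : (Finsupp.equivFunOnFinite.symm a).degree = ∑ i, a i := by
      rw [Finsupp.degree_eq_sum]; simp
    have e4 : ∑ i : Fin n, (L-1) = n * (L-1) := by simp
    rw [e1, tau1_zz_yy, e2]
    split_ifs with h
    · subst h
      rw [h2 _ (by rw [e3, e4])]
      simp
    · rw [h1, zero_smul]
      apply monomial_mem_Wd
      rw [e3, ← e4]
      apply Finset.sum_lt_sum (fun i _ => ha' i)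
      by_contra hc
      push Not at hc
      exact h (funext fun i => le_antisymm (ha' i) (hc i (Finset.mem_univ i)))
  rw [Finset.sum_congr rfl key, Finset.sum_ite_eq' , if_pos]
  rw [Fintype.mem_piFinset]
  intro i; simp; omega

lemma exists_decomp (G : MvPolynomial (Fin n ⊕ Fin n) ℂ) :
    ∃ m : ℕ, ∃ b c : Fin m → MvPolynomial (Fin n) ℂ, G = ∑ k, zz (b k) * yy (c k) := by
  induction G using induct_zy with
  | h1 p q => exact ⟨1, fun _ => p, fun _ => q, by simp⟩
  | h2 x y hx hy =>
    obtain ⟨m, b, c, rfl⟩ := hx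
    obtain ⟨m', b', c', rfl⟩ := hy
    refine ⟨m + m', Fin.append b b', Fin.append c c', ?_⟩
    rw [Fin.sum_univ_add]
    simp

lemma det_lead (A H : Matrix (Fin n) (Fin n) (MvPolynomial (Fin n ⊕ Fin n) ℂ)) (d : ℕ)
    (h : ∀ i j, Lead d (A i j) (H i j)) : A.det - H.det ∈ Wd (Fin n ⊕ Fin n) (n * d) := by
  rw [Matrix.det_apply, Matrix.det_apply, ← Finset.sum_sub_distrib]
  refine sum_mem fun σ _ => ?_
  rw [← smul_sub]
  have := (Lead.prod Finset.univ (d := fun _ => d) (a := fun i => A (σ i) i)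
    (b := fun i => H (σ i) i) (fun i _ => h _ _)).2
  simp only [Finset.sum_const, Finset.card_univ, Fintype.card_fin, smul_eq_mul] at this
  rcases Int.units_eq_one_or (Equiv.Perm.sign σ) with hs | hs
  · rw [hs, one_smul]; exact this
  · rw [hs, Units.neg_smul, one_smul]; exact neg_mem this

theorem frobenius {L : ℕ} {P : Fin n → MvPolynomial (Fin n) ℂ} (hL : 0 < L)
    (hP : ∀ i, P i ∈ Wd (Fin n) L) :
    ∃ τ : (Fin n → ℂ) → (MvPolynomial (Fin n) ℂ →ₗ[ℂ] ℂ),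
    ∃ m : ℕ, ∃ b c : Fin m → MvPolynomial (Fin n) ℂ,
      (∀ w i p, τ w ((FF L P i - C (w i)) * p) = 0) ∧
      (∀ p, Continuous fun w => τ w p) ∧
      (∑ k, b k * c k = Matrix.det (Matrix.of fun i j => pderiv j (FF L P i))) ∧
      ∀ w x, x - ∑ k, τ w (x * b k) • c k ∈
        Ideal.span (Set.range fun i => FF L P i - C (w i)) := by
  classical
  obtain ⟨τ, t1, t2, t3, t4⟩ := exists_tau hL hP
  have hPg : ∀ i, Good (L-1) (P i) := fun i => good_of_mem (by
    rw [Nat.sub_add_cancel hL]; exact hP i)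
  choose B b1 b2 b3 using hPg
  let A : Matrix (Fin n) (Fin n) (MvPolynomial (Fin n ⊕ Fin n) ℂ) :=
    Matrix.of fun i j => B i j + if i = j then hh L i else 0
  have hA : ∀ i, zz (FF L P i) - yy (FF L P i) =
      ∑ j, A i j * (X (Sum.inl j) - X (Sum.inr j)) := by
    intro i
    have e1 : zz (FF L P i) - yy (FF L P i) = (zz (P i) - yy (P i)) +
        (X (Sum.inl i) ^ L - X (Sum.inr i) ^ L) := by
      simp only [zz, yy, FF, map_add, map_pow, rename_X]; ring
    have e2 : hh L i * (X (Sum.inl i) - X (Sum.inr i)) =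
        X (Sum.inl i) ^ L - X (Sum.inr i) ^ L :=
      (Commute.all _ _).geom_sum₂_mul L
    rw [e1, b2, ← e2]
    simp only [A, Matrix.of_apply, add_mul, Finset.sum_add_distrib, ite_mul, zero_mul,
      Finset.sum_ite_eq, Finset.mem_univ, if_true]
  have hAd : ∀ i j, diagMap n (A i j) = pderiv j (FF L P i) := by
    intro i j
    simp only [A, Matrix.of_apply, FF, map_add, b3]
    congr 1
    rw [Derivation.leibniz_pow, pderiv_X]
    by_cases h : i = j
    · subst h
      simp only [if_true, hh, map_sum, map_mul, map_pow]
      have x1 : diagMap n (X (Sum.inl i)) = X i := by simp [diagMap]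
      have x2 : diagMap n (X (Sum.inr i)) = X i := by simp [diagMap]
      rw [x1, x2]
      have : ∀ a ∈ Finset.range L, (X i : MvPolynomial (Fin n) ℂ) ^ a * X i ^ (L - 1 - a) =
          X i ^ (L-1) := by
        intro a ha
        have := Finset.mem_range.mp ha
        rw [← pow_add]; congr 1; omega
      rw [Finset.sum_congr rfl this]
      simp
    · rw [if_neg h, Pi.single_apply, if_neg h]; simp
  obtain ⟨m, b, c, hbc⟩ := exists_decomp A.det
  refine ⟨τ, m, b, c, t1, t4, ?_, ?_⟩
  · have := congrArg (diagMap n) hbc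
    rw [map_sum] at this
    simp only [map_mul, diag_zz, diag_yy] at this
    rw [← this, AlgHom.map_det]
    congr 1
    ext1 i j
    simp [hAd]
  · intro w x
    have hlead : A.det - (Matrix.diagonal (hh L)).det ∈ Wd (Fin n ⊕ Fin n) (n * (L-1)) := by
      apply det_lead
      intro i j
      simp only [A, Matrix.of_apply, Matrix.diagonal_apply]
      refine ⟨?_, ?_⟩
      · split_ifs
        · exact hh_mem hL i
        · simp
      · simpa using b1 i j
    have hone : tau1 (τ w) A.det = 1 := by
      have := tau1_low (τ w) _ (t2 w) _ hlead
      rw [map_sub, sub_eq_zero] at this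
      rw [this, Matrix.det_diagonal]
      exact tau1_prod_hh hL (τ w) (t2 w) (t3 w)
    have hI : ∀ i G, tau1 (τ w) ((zz (FF L P i) - yy (FF L P i)) * G) ∈
        Ideal.span (Set.range fun i => FF L P i - C (w i)) := by
      intro i G
      have e1 : zz (FF L P i) - yy (FF L P i) = zz (FF L P i - C (w i)) - yy (FF L P i - C (w i)) := by
        simp [zz, yy]
      rw [e1, sub_mul, map_sub, tau1_zz_mul _ _ (t1 w i), tau1_yy_mul, zero_sub]
      exact neg_mem (Ideal.mul_mem_right _ _ (Ideal.subset_span ⟨i, rfl⟩))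
    have hd : ∀ j, A.det * (X (Sum.inl j) - X (Sum.inr j)) =
        ∑ i, A.adjugate j i * (zz (FF L P i) - yy (FF L P i)) := by
      intro j
      have e0 : A.mulVec (fun j => X (Sum.inl j) - X (Sum.inr j)) =
          fun i => zz (FF L P i) - yy (FF L P i) := by
        funext i; rw [hA]; rfl
      have e1 : A.adjugate.mulVec (A.mulVec (fun j => X (Sum.inl j) - X (Sum.inr j))) j =
          A.det * (X (Sum.inl j) - X (Sum.inr j)) := by
        rw [Matrix.mulVec_mulVec, Matrix.adjugate_mul, Matrix.smul_mulVec, Matrix.one_mulVec]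
        rfl
      rw [← e1, e0]; rfl
    obtain ⟨D, hD⟩ := exists_mem_Wd x
    obtain ⟨E, _, hE, _⟩ := good_of_mem (Wd_mono (Nat.le_succ D) hD)
    have hmem : tau1 (τ w) (A.det * (zz x - yy x)) ∈
        Ideal.span (Set.range fun i => FF L P i - C (w i)) := by
      rw [hE, Finset.mul_sum, map_sum]
      refine sum_mem fun j _ => ?_
      rw [mul_left_comm, hd, Finset.mul_sum, map_sum]
      refine sum_mem fun i _ => ?_
      rw [← mul_assoc, mul_comm]
      exact hI i _
    rw [mul_sub, map_sub, mul_comm A.det (yy x), tau1_yy_mul, hone, mul_one, hbc,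
      Finset.sum_mul, map_sum] at hmem
    have e5 : ∀ k, tau1 (τ w) (zz (b k) * yy (c k) * zz x) = τ w (x * b k) • c k := by
      intro k
      have : zz (b k) * yy (c k) * zz x = zz (x * b k) * yy (c k) := by
        simp only [zz, yy, map_mul]; ring
      rw [this, tau1_zz_yy]
    simp only [e5] at hmem
    rw [← neg_mem_iff, neg_sub]
    exact hmem
end Bez
end JacAux


namespace JacAux
open MvPolynomial

section Mat
variable {A : Type*} [CommRing A] [Algebra ℂ A] {m : ℕ}

/-- matrix of multiplication -/
noncomputable def MM (τ : A →ₗ[ℂ] ℂ) (b c : Fin m → A) (g : A) : Matrix (Fin m) (Fin m) ℂ :=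
  Matrix.of fun i k => τ (g * c k * b i)

lemma MM_mul {τ : A →ₗ[ℂ] ℂ} {b c : Fin m → A} {I : Ideal A} (hI : ∀ x ∈ I, τ x = 0)
    (h : ∀ x, x - ∑ k, τ (x * b k) • c k ∈ I) (g g' : A) :
    MM τ b c g * MM τ b c g' = MM τ b c (g * g') := by
  ext i k
  simp only [MM, Matrix.mul_apply, Matrix.of_apply]
  have h1 := hI _ (I.mul_mem_left (g * b i) (h (g' * c k)))
  rw [mul_sub, map_sub, sub_eq_zero, Finset.mul_sum, map_sum] at h1
  have h2 : g * g' * c k * b i = g * b i * (g' * c k) := by ring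
  rw [h2, h1]
  refine Finset.sum_congr rfl fun j _ => ?_
  rw [mul_smul_comm, map_smul, smul_eq_mul, mul_comm]
  congr 2
  ring

lemma MM_pow {τ : A →ₗ[ℂ] ℂ} {b c : Fin m → A} {I : Ideal A} (hI : ∀ x ∈ I, τ x = 0)
    (h : ∀ x, x - ∑ k, τ (x * b k) • c k ∈ I) (g : A) (N : ℕ) :
    MM τ b c g ^ (N+1) = MM τ b c (g ^ (N+1)) := by
  induction N with
  | zero => simp
  | succ N ih => rw [pow_succ, ih, MM_mul hI h, ← pow_succ]

lemma tau_trace {τ : A →ₗ[ℂ] ℂ} {b c : Fin m → A} {I : Ideal A} (hI : ∀ x ∈ I, τ x = 0)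
    (h : ∀ x, x - ∑ k, τ (x * b k) • c k ∈ I) (g : A) (hg : g ∈ I.radical) :
    τ (g * ∑ k, b k * c k) = 0 := by
  obtain ⟨N, hN⟩ := hg
  have h0 : MM τ b c (g ^ (N+1)) = 0 := by
    ext i k
    simp only [MM, Matrix.of_apply, Matrix.zero_apply]
    apply hI
    apply I.mul_mem_right
    apply I.mul_mem_right
    rw [pow_succ]
    exact I.mul_mem_right _ hN
  have hn : IsNilpotent (MM τ b c g) := ⟨N+1, by rw [MM_pow hI h, h0]⟩
  have := (Matrix.isNilpotent_trace_of_isNilpotent hn).eq_zero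
  rw [← this, Matrix.trace, Finset.mul_sum, map_sum]
  refine Finset.sum_congr rfl fun j _ => ?_
  simp only [MM, Matrix.diag, Matrix.of_apply]
  congr 1
  ring

lemma key_T {τ : A →ₗ[ℂ] ℂ} {b c : Fin m → A} {I : Ideal A} (hI : ∀ x ∈ I, τ x = 0)
    (h : ∀ x, x - ∑ k, τ (x * b k) • c k ∈ I) (M : Ideal A)
    (hrad : ∀ g : A, (∀ v ∈ M, g * v ∈ I) → g ∈ I.radical) :
    ∑ k, b k * c k ∈ I ⊔ M := by
  by_contra hne
  have hne' : ∑ k, b k * c k ∉ (I ⊔ M).restrictScalars ℂ := hne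
  obtain ⟨φ, hφ, hle⟩ := Submodule.exists_le_ker_of_notMem hne'
  have hφI : ∀ x ∈ I, φ x = 0 := fun x hx => hle (show x ∈ I ⊔ M from Ideal.mem_sup_left hx)
  have hφM : ∀ x ∈ M, φ x = 0 := fun x hx => hle (show x ∈ I ⊔ M from Ideal.mem_sup_right hx)
  set g := ∑ k, φ (c k) • b k with hg
  have hgx : ∀ x, τ (g * x) = φ x := by
    intro x
    have h1 := hφI _ (h x)
    rw [map_sub, sub_eq_zero, map_sum] at h1
    rw [h1, hg, Finset.sum_mul, map_sum]
    refine Finset.sum_congr rfl fun j _ => ?_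
    rw [smul_mul_assoc, map_smul, map_smul, smul_eq_mul, smul_eq_mul, mul_comm, mul_comm x]
  have hgM : ∀ v ∈ M, g * v ∈ I := by
    intro v hv
    have h1 := h (g * v)
    have : ∑ k, τ (g * v * b k) • c k = 0 := by
      refine Finset.sum_eq_zero fun j _ => ?_
      rw [mul_assoc, hgx, hφM _ (M.mul_mem_right _ hv), zero_smul]
    rwa [this, sub_zero] at h1
  have := tau_trace hI h g (hrad g hgM)
  rw [hgx] at this
  exact hφ this

end Mat

theorem theoremT {n L : ℕ} {P : Fin n → MvPolynomial (Fin n) ℂ} (hL : 0 < L)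
    (hP : ∀ i, P i ∈ Wd (Fin n) L) (K : ℕ)
    (hno : ∀ g : MvPolynomial (Fin n) ℂ, eval 0 g ≠ 0 →
      ∃ v ∈ (Ideal.span (Set.range (X : Fin n → MvPolynomial (Fin n) ℂ))) ^ K,
        g * v ∉ Ideal.span (Set.range (FF L P))) :
    Matrix.det (Matrix.of fun i j => pderiv j (FF L P i)) ∈
      Ideal.span (Set.range (FF L P)) ⊔ (Ideal.span (Set.range (X : Fin n → MvPolynomial (Fin n) ℂ))) ^ K := by
  obtain ⟨τ, m, b, c, h1, -, h3, h4⟩ := frobenius hL hP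
  have hs : (Set.range fun i => FF L P i - C ((0 : Fin n → ℂ) i)) = Set.range (FF L P) := by
    congr 1; ext1 i; simp
  have hI : ∀ x ∈ Ideal.span (Set.range (FF L P)), τ 0 x = 0 := by
    intro x hx
    induction hx using Submodule.span_induction with
    | mem x hx => 
      obtain ⟨i, rfl⟩ := hx
      have := h1 0 i 1
      simpa using this
    | zero => simp
    | add x y _ _ hx hy => rw [map_add, hx, hy, add_zero]
    | smul a x hx' hx =>
      obtain ⟨q, rfl⟩ := Ideal.mem_span_range_iff_exists_fun.mp hx'
      rw [smul_eq_mul, Finset.mul_sum, map_sum]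
      refine Finset.sum_eq_zero fun i _ => ?_
      have := h1 0 i (a * q i)
      rw [← this]
      congr 1
      simp
      ring
  have h4' := h4 0
  rw [hs] at h4'
  rw [← h3]
  refine key_T hI h4' _ fun g hg => ?_
  rw [← vanishingIdeal_zeroLocus_eq_radical (K := ℂ), mem_vanishingIdeal_iff]
  intro z hz
  have hg0 : eval 0 g = 0 := by
    by_contra hne
    obtain ⟨v, hv, hv'⟩ := hno g hne
    exact hv' (hg v hv)
  rw [aeval_eq_eval]
  by_cases hz0 : z = 0
  · subst hz0; exact hg0
  obtain ⟨j, hj⟩ := Function.ne_iff.mp hz0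
  have h5 := hg ((X j)^K) (Ideal.pow_mem_pow (Ideal.subset_span (Set.mem_range_self j)) K)
  rw [mem_zeroLocus_iff] at hz
  have h6 := hz _ h5
  simp only [map_mul, map_pow, aeval_X, mul_eq_zero] at h6
  rcases h6 with h6 | h6
  · exact h6
  · exact absurd (eq_zero_of_pow_eq_zero h6) hj

end JacAux


namespace JacAux
open MvPolynomial

section
variable {n m : ℕ} 

lemma eig_of_zero {τ : MvPolynomial (Fin n) ℂ →ₗ[ℂ] ℂ} {b c : Fin m → MvPolynomial (Fin n) ℂ}
    {I : Ideal (MvPolynomial (Fin n) ℂ)}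
    (h : ∀ x, x - ∑ k, τ (x * b k) • c k ∈ I) (g : MvPolynomial (Fin n) ℂ) (ζ : Fin n → ℂ)
    (hζ : ∀ p ∈ I, eval ζ p = 0) : (MM τ b c g).charpoly.eval (eval ζ g) = 0 := by
  rw [Matrix.eval_charpoly]
  rw [← Matrix.exists_vecMul_eq_zero_iff]
  refine ⟨fun k => eval ζ (c k), ?_, ?_⟩
  · intro h0
    have h1 := hζ _ (h 1)
    rw [map_sub, map_sum] at h1
    have : ∀ k, eval ζ (c k) = 0 := fun k => congrFun h0 k
    simp [smul_eval, this] at h1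
  · ext k
    rw [Matrix.vecMul_sub, Pi.sub_apply, Pi.zero_apply, sub_eq_zero]
    have h1 := hζ _ (h (g * c k))
    rw [map_sub, map_sum, sub_eq_zero, map_mul] at h1
    have h2 : Matrix.vecMul (fun k => eval ζ (c k)) ((Matrix.scalar (Fin m)) (eval ζ g)) k
        = eval ζ g * eval ζ (c k) := by
      simp [Matrix.scalar_apply, Matrix.vecMul_diagonal, mul_comm]
    rw [h2, h1]
    simp only [Matrix.vecMul, dotProduct, MM, Matrix.of_apply, smul_eval]
    exact Finset.sum_congr rfl fun i _ => mul_comm _ _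

lemma zero_of_eig {τ : MvPolynomial (Fin n) ℂ →ₗ[ℂ] ℂ} {b c : Fin m → MvPolynomial (Fin n) ℂ}
    {I : Ideal (MvPolynomial (Fin n) ℂ)} (hI : ∀ x ∈ I, τ x = 0)
    (h : ∀ x, x - ∑ k, τ (x * b k) • c k ∈ I) (g : MvPolynomial (Fin n) ℂ) (lam : ℂ)
    (hl : lam ≠ 0) (hlam : (MM τ b c g).charpoly.eval lam = 0) :
    ∃ ζ, (∀ p ∈ I, eval ζ p = 0) ∧ eval ζ g = lam := by
  rw [Matrix.eval_charpoly, ← Matrix.exists_mulVec_eq_zero_iff] at hlam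
  obtain ⟨v, hv0, hv⟩ := hlam
  rw [Matrix.sub_mulVec, sub_eq_zero] at hv
  have hv' : ∀ i, lam * v i = ∑ k, τ (g * c k * b i) * v k := by
    intro i
    have := congrFun hv i
    simpa [Matrix.scalar_apply, Matrix.mulVec_diagonal, Matrix.mulVec, dotProduct, MM,
      Matrix.diagonal_apply] using this
  set x := ∑ k, v k • c k with hx
  have hgx : (g - C lam) * x ∈ I := by
    have h1 : ∑ k, v k • (g * c k - ∑ i, τ (g * c k * b i) • c i) ∈ I := 
      I.sum_mem fun k _ => by
        rw [smul_eq_C_mul]; exact I.mul_mem_left _ (h _)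
    convert h1 using 1
    simp only [smul_sub, Finset.sum_sub_distrib, Finset.smul_sum]
    rw [Finset.sum_comm, sub_mul, hx, Finset.mul_sum, Finset.mul_sum]
    congr 1
    · exact Finset.sum_congr rfl fun k _ => by rw [mul_smul_comm]
    · refine Finset.sum_congr rfl fun i _ => ?_
      simp only [smul_smul]
      rw [← Finset.sum_smul, ← smul_eq_C_mul, smul_smul, hv']
      congr 1
      exact Finset.sum_congr rfl fun k _ => mul_comm _ _
  by_contra hne
  push Not at hne
  have htop : (1 : MvPolynomial (Fin n) ℂ) ∈ I ⊔ Ideal.span {g - C lam} := by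
    rw [← Ideal.eq_top_iff_one, ← Ideal.radical_eq_top, ← vanishingIdeal_zeroLocus_eq_radical (K := ℂ),
      Ideal.eq_top_iff_one, mem_vanishingIdeal_iff]
    intro ζ hζ
    exfalso
    rw [mem_zeroLocus_iff] at hζ
    refine hne ζ (fun p hp => ?_) ?_
    · have := hζ p (Ideal.mem_sup_left hp)
      rwa [aeval_eq_eval] at this
    · have := hζ _ (Ideal.mem_sup_right (Ideal.subset_span rfl))
      rw [aeval_eq_eval] at this
      simpa [sub_eq_zero] using this
  obtain ⟨y, hy, z, hz, hyz⟩ := Submodule.mem_sup.mp htop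
  obtain ⟨a, rfl⟩ := Ideal.mem_span_singleton.mp hz
  have hxI : x ∈ I := by
    have : x = x * y + a * ((g - C lam) * x) := by
      calc x = x * 1 := (mul_one x).symm
        _ = _ := by rw [← hyz]; ring
    rw [this]
    exact I.add_mem (I.mul_mem_left _ hy) (I.mul_mem_left _ hgx)
  apply hv0
  ext i
  have h3 := hI _ (I.mul_mem_left (g * b i) hxI)
  have : lam * v i = 0 := by
    rw [hv', ← h3, hx, Finset.mul_sum, map_sum]
    refine Finset.sum_congr rfl fun k _ => ?_
    rw [mul_smul_comm, map_smul, smul_eq_mul, mul_comm]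
    congr 2
    ring
  simpa [hl] using this

end

lemma eval_bound {n L : ℕ} {p : MvPolynomial (Fin n) ℂ} (hp : p ∈ Wd (Fin n) L) :
    ∃ C : ℝ, 0 ≤ C ∧ ∀ z : Fin n → ℂ, 1 ≤ ‖z‖ → ‖eval z p‖ ≤ C * ‖z‖ ^ (L - 1) := by
  refine ⟨∑ γ ∈ p.support, ‖coeff γ p‖, Finset.sum_nonneg fun _ _ => norm_nonneg _, fun z hz => ?_⟩
  rw [eval_eq, Finset.sum_mul]
  refine (norm_sum_le _ _).trans (Finset.sum_le_sum fun γ hγ => ?_)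
  rw [norm_mul]
  gcongr
  rw [norm_prod]
  calc ∏ i ∈ γ.support, ‖z i ^ γ i‖ ≤ ∏ i ∈ γ.support, ‖z‖ ^ γ i := by
        refine Finset.prod_le_prod (fun _ _ => norm_nonneg _) fun i _ => ?_
        rw [norm_pow]
        gcongr
        exact norm_le_pi_norm z i
    _ = ‖z‖ ^ γ.degree := by rw [Finset.prod_pow_eq_pow_sum]; rfl
    _ ≤ ‖z‖ ^ (L - 1) := by
        have := mem_Wd.mp hp γ hγ
        exact pow_le_pow_right₀ hz (by omega)

/-- the polynomial map -/
noncomputable def FM {n : ℕ} (L : ℕ) (P : Fin n → MvPolynomial (Fin n) ℂ) (z : Fin n → ℂ) : Fin n → ℂ :=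
  fun i => eval z (FF L P i)

lemma continuous_FM {n : ℕ} (L : ℕ) (P : Fin n → MvPolynomial (Fin n) ℂ) : Continuous (FM L P) :=
  continuous_pi fun i => (FF L P i).continuous_eval

lemma proper_FM {n L : ℕ} {P : Fin n → MvPolynomial (Fin n) ℂ} (hL : 0 < L)
    (hP : ∀ i, P i ∈ Wd (Fin n) L) : IsProperMap (FM L P) := by
  rw [isProperMap_iff_tendsto_cocompact]
  refine ⟨continuous_FM L P, ?_⟩
  choose C hC0 hC using fun i => eval_bound (hP i)
  set D := ∑ i, C i with hD
  have hCD : ∀ i, C i ≤ D := fun i => Finset.single_le_sum (fun j _ => hC0 j) (Finset.mem_univ i)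
  have key : ∀ z : Fin n → ℂ, 1 ≤ ‖z‖ → ‖z‖ - D ≤ ‖FM L P z‖ := by
    intro z hz
    by_cases hzD : ‖z‖ ≤ D
    · exact (sub_nonpos.mpr hzD).trans (norm_nonneg _)
    push Not at hzD
    have hne : Nonempty (Fin n) := by
      by_contra h
      rw [not_nonempty_iff] at h
      have : z = 0 := Subsingleton.elim _ _
      rw [this, norm_zero] at hz
      linarith
    obtain ⟨i, hi⟩ := Finite.exists_max (fun i => ‖z i‖)
    have hzi : ‖z‖ = ‖z i‖ := le_antisymm ((pi_norm_le_iff_of_nonneg (norm_nonneg _)).mpr hi) (norm_le_pi_norm z i)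
    have h1 : ‖FM L P z i‖ ≤ ‖FM L P z‖ := norm_le_pi_norm _ i
    have h2 : FM L P z i = eval z (P i) + z i ^ L := by simp [FM, FF]
    have h3 : ‖z i ^ L‖ ≤ ‖FM L P z i‖ + ‖eval z (P i)‖ := by
      have : z i ^ L = FM L P z i - eval z (P i) := by rw [h2]; ring
      rw [this]; exact norm_sub_le _ _
    rw [norm_pow, ← hzi] at h3
    have h4 := hC i z hz
    have h5 : ‖z‖ ^ L = ‖z‖ ^ (L-1) * ‖z‖ := by rw [← pow_succ]; congr 1; omega
    have h6 : 1 ≤ ‖z‖ ^ (L-1) := one_le_pow₀ hz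
    have h7 : C i * ‖z‖ ^ (L-1) ≤ D * ‖z‖ ^ (L-1) := by gcongr; exact hCD i
    nlinarith
  rw [← Metric.cobounded_eq_cocompact, ← tendsto_norm_atTop_iff_cobounded, Metric.cobounded_eq_cocompact]
  have h1 : Filter.Tendsto (fun z : Fin n → ℂ => ‖z‖) (Filter.cocompact _) Filter.atTop := tendsto_norm_cocompact_atTop
  refine Filter.tendsto_atTop_mono' _ ?_ (Filter.tendsto_atTop_add_const_right _ (-D) h1)
  filter_upwards [h1.eventually_ge_atTop 1] with z hz
  exact key z hz

lemma tau_kills {n L : ℕ} {P : Fin n → MvPolynomial (Fin n) ℂ} {w : Fin n → ℂ}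
    {τ : MvPolynomial (Fin n) ℂ →ₗ[ℂ] ℂ}
    (h1 : ∀ i p, τ ((FF L P i - C (w i)) * p) = 0) :
    ∀ x ∈ Ideal.span (Set.range fun i => FF L P i - C (w i)), τ x = 0 := by
  intro x hx
  obtain ⟨q, rfl⟩ := Ideal.mem_span_range_iff_exists_fun.mp hx
  rw [map_sum]
  refine Finset.sum_eq_zero fun i _ => ?_
  rw [mul_comm]; exact h1 i (q i)

lemma mem_zeros_iff {n L : ℕ} {P : Fin n → MvPolynomial (Fin n) ℂ} {w ζ : Fin n → ℂ} :
    (∀ p ∈ Ideal.span (Set.range fun i => FF L P i - C (w i)), eval ζ p = 0) ↔ FM L P ζ = w := by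
  constructor
  · intro h
    ext i
    have := h _ (Ideal.subset_span (Set.mem_range_self i))
    simpa [sub_eq_zero, FM] using this
  · rintro rfl p hp
    obtain ⟨q, rfl⟩ := Ideal.mem_span_range_iff_exists_fun.mp hp
    rw [map_sum]
    refine Finset.sum_eq_zero fun i _ => ?_
    simp [FM]

lemma multiset_bound {R : Multiset ℂ} {m : ℕ} (hcard : Multiset.card R = m)
    (hroots : ∀ lam ∈ R, 1/2 ≤ ‖1 - lam‖) :
    (1/2 : ℝ) ^ m ≤ ‖(R.map (fun x => 1 - x)).prod‖ := by
  subst hcard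
  induction R using Multiset.induction_on with
  | empty => simp
  | cons a R ih =>
    simp only [Multiset.map_cons, Multiset.prod_cons, Multiset.card_cons, norm_mul, pow_succ']
    have h7 := ih fun lam hl => hroots lam (Multiset.mem_cons_of_mem hl)
    have h8 := hroots a (Multiset.mem_cons_self a R)
    gcongr

theorem open_FM {n L : ℕ} {P : Fin n → MvPolynomial (Fin n) ℂ} (hL : 0 < L)
    (hP : ∀ i, P i ∈ Wd (Fin n) L) : IsOpenMap (FM L P) := by
  obtain ⟨τ, m, b, c, h1, h2, -, h4⟩ := frobenius hL hP
  rw [isOpenMap_iff_nhds_le]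
  intro z0 s hs
  rw [Filter.mem_map] at hs
  obtain ⟨ε, hε, hball⟩ := Metric.mem_nhds_iff.mp hs
  set w0 := FM L P z0 with hw0
  -- polynomial h
  have hq : ∀ i : Fin n, ∃ q : Polynomial ℂ, q.eval (z0 i) ≠ 0 ∧
      ∀ ζ, FM L P ζ = w0 → ζ i ≠ z0 i → q.eval (ζ i) = 0 := by
    intro i
    set p := (MM (τ w0) b c (X i)).charpoly with hp
    have hp0 : p ≠ 0 := (Matrix.charpoly_monic _).ne_zero
    obtain ⟨q, hq, hdiv⟩ := Polynomial.exists_eq_pow_rootMultiplicity_mul_and_not_dvd p hp0 (z0 i)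
    refine ⟨q, fun h0 => hdiv (Polynomial.dvd_iff_isRoot.mpr h0), fun ζ hζ hne => ?_⟩
    have h5 := eig_of_zero (h4 w0) (X i) ζ (mem_zeros_iff.mpr hζ)
    rw [← hp, hq] at h5
    simp only [eval_X, Polynomial.eval_mul, Polynomial.eval_pow, Polynomial.eval_sub, Polynomial.eval_X,
      Polynomial.eval_C, mul_eq_zero] at h5
    rcases h5 with h5 | h5
    · exact absurd (sub_eq_zero.mp (eq_zero_of_pow_eq_zero h5)) hne
    · exact h5
  choose q hq1 hq2 using hq
  set h : MvPolynomial (Fin n) ℂ := ∏ i, C (((q i).eval (z0 i))⁻¹) * Polynomial.aeval (X i) (q i) with hh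
  have hev : ∀ ζ, eval ζ h = ∏ i, ((q i).eval (z0 i))⁻¹ * (q i).eval (ζ i) := by
    intro ζ
    rw [hh, map_prod]
    refine Finset.prod_congr rfl fun i _ => ?_
    rw [map_mul, eval_C]
    congr 1
    rw [← aeval_eq_eval, ← Polynomial.aeval_algHom_apply, aeval_X, Polynomial.coe_aeval_eq_eval]
  have hev0 : eval z0 h = 1 := by
    rw [hev]
    exact Finset.prod_eq_one fun i _ => inv_mul_cancel₀ (hq1 i)
  have hev1 : ∀ ζ, FM L P ζ = w0 → ζ ≠ z0 → eval ζ h = 0 := by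
    intro ζ hζ hne
    obtain ⟨i, hi⟩ := Function.ne_iff.mp hne
    rw [hev]
    exact Finset.prod_eq_zero (Finset.mem_univ i) (by rw [hq2 i ζ hζ hi, mul_zero])
  -- closed set
  set S : Set (Fin n → ℂ) := {z | ε ≤ dist z z0 ∧ 1/2 ≤ ‖eval z h‖} with hS
  have hSc : IsClosed S := by
    have e1 : IsClosed {z : Fin n → ℂ | ε ≤ dist z z0} :=
      isClosed_le continuous_const (continuous_id.dist continuous_const)
    have e2 : IsClosed {z : Fin n → ℂ | 1/2 ≤ ‖eval z h‖} :=
      isClosed_le continuous_const h.continuous_eval.norm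
    exact e1.inter e2
  have hFS := (proper_FM hL hP).isClosedMap S hSc
  have hw0S : w0 ∉ FM L P '' S := by
    rintro ⟨z, hz, hzw⟩
    have hne : z ≠ z0 := by
      rintro rfl
      have := hz.1
      rw [dist_self] at this
      linarith
    have := hz.2
    rw [hev1 z hzw hne] at this
    norm_num at this
  -- determinant
  set D : (Fin n → ℂ) → ℂ := fun w => (MM (τ w) b c h).charpoly.eval 1 with hD
  have hDc : Continuous D := by
    simp only [hD, Matrix.eval_charpoly]
    refine Continuous.matrix_det ?_
    refine continuous_const.sub (continuous_matrix fun i j => ?_)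
    exact h2 _
  have hD0 : D w0 = 0 := by
    have := eig_of_zero (h4 w0) h z0 (mem_zeros_iff.mpr rfl)
    rwa [hev0] at this
  have hsmall : ∀ᶠ w in nhds w0, ‖D w‖ < (1/2)^m := by
    have : Filter.Tendsto (fun w => ‖D w‖) (nhds w0) (nhds ‖D w0‖) := hDc.norm.continuousAt
    rw [hD0, norm_zero] at this
    exact this.eventually_lt_const (by positivity)
  filter_upwards [hsmall, hFS.isOpen_compl.mem_nhds hw0S] with w hw1 hw2
  by_contra hws
  refine absurd hw1 (not_lt.mpr ?_)
  have hmon := Matrix.charpoly_monic (MM (τ w) b c h)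
  have hspl : (MM (τ w) b c h).charpoly.Splits := IsAlgClosed.splits _
  have hdeg := Matrix.charpoly_natDegree_eq_dim (MM (τ w) b c h)
  rw [Fintype.card_fin] at hdeg
  simp only [hD]
  rw [hspl.eval_eq_prod_roots_of_monic hmon]
  have hcard : Multiset.card (MM (τ w) b c h).charpoly.roots = m := by
    rw [← hspl.natDegree_eq_card_roots, hdeg]
  have hroots : ∀ lam ∈ (MM (τ w) b c h).charpoly.roots, 1/2 ≤ ‖1 - lam‖ := by
    intro lam hl
    have hr := (Polynomial.mem_roots'.mp hl).2
    by_cases hl0 : lam = 0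
    · rw [hl0]; norm_num
    obtain ⟨ζ, hζ1, hζ2⟩ := zero_of_eig (tau_kills (h1 w)) (h4 w) h lam hl0 hr
    rw [mem_zeros_iff] at hζ1
    have hlt : ‖lam‖ < 1/2 := by
      by_contra hge
      push Not at hge
      apply hw2
      refine ⟨ζ, ⟨?_, by rw [hζ2]; exact hge⟩, hζ1⟩
      by_contra hd
      push Not at hd
      apply hws
      rw [← hζ1]
      exact hball hd
    have := norm_sub_norm_le (1:ℂ) lam
    rw [norm_one] at this
    linarith
  exact multiset_bound hcard hroots

end JacAux


namespace JacAux
open MvPolynomial Filter Asymptotics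
open scoped Topology

section series
variable {n : ℕ}

/-- monomial function -/
noncomputable def mon (z : Fin n → ℂ) (α : Fin n →₀ ℕ) : ℂ := α.prod fun i k => z i ^ k

lemma mon_zero (z : Fin n → ℂ) : mon z 0 = 1 := by simp [mon]

lemma mon_add (z : Fin n → ℂ) (α β : Fin n →₀ ℕ) : mon z (α + β) = mon z α * mon z β := by
  unfold mon
  exact Finsupp.prod_add_index' (fun _ => pow_zero _) (fun _ _ _ => pow_add _ _ _)

lemma mon_single (z : Fin n → ℂ) (i : Fin n) (k : ℕ) : mon z (Finsupp.single i k) = z i ^ k := by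
  unfold mon
  exact Finsupp.prod_single_index (pow_zero _)

lemma norm_mon_le (z : Fin n → ℂ) (α : Fin n →₀ ℕ) : ‖mon z α‖ ≤ ‖z‖ ^ α.degree := by
  induction α using Finsupp.induction_linear with
  | zero => simp [mon_zero]
  | add f g hf hg =>
    rw [mon_add, norm_mul, map_add, pow_add]
    gcongr
  | single i k =>
    rw [mon_single, norm_pow, Finsupp.degree_single]
    gcongr
    exact norm_le_pi_norm z i

/-- words -/
abbrev Wrd (n : ℕ) := Σ k : ℕ, (Fin k → Fin n)

/-- exponent of word -/
noncomputable def wexp (w : Wrd n) : Fin n →₀ ℕ := ∑ l, Finsupp.single (w.2 l) 1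

lemma wexp_degree (w : Wrd n) : (wexp w).degree = w.1 := by
  simp [wexp, map_sum, Finsupp.degree_single]

lemma mon_wexp (z : Fin n → ℂ) (w : Wrd n) : mon z (wexp w) = ∏ l, z (w.2 l) := by
  unfold wexp
  have : ∀ s : Finset (Fin w.1), mon z (∑ l ∈ s, Finsupp.single (w.2 l) 1) = ∏ l ∈ s, z (w.2 l) := by
    intro s
    induction s using Finset.induction_on with
    | empty => simp [mon_zero]
    | insert a s ha ih => rw [Finset.sum_insert ha, Finset.prod_insert ha, mon_add, ih, mon_single, pow_one]
  exact this _

lemma wexp_surj : Function.Surjective (wexp (n := n)) := by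
  intro α
  induction α using Finsupp.induction_linear with
  | zero => exact ⟨⟨0, Fin.elim0⟩, by simp [wexp]⟩
  | add f g hf hg =>
    obtain ⟨⟨k, s⟩, rfl⟩ := hf
    obtain ⟨⟨l, t⟩, rfl⟩ := hg
    refine ⟨⟨k + l, Fin.append s t⟩, ?_⟩
    simp [wexp, Fin.sum_univ_add]
  | single i k =>
    refine ⟨⟨k, fun _ => i⟩, ?_⟩
    simp [wexp]

/-- `f` is the sum of the power series `c` on the polydisc of radius `r` -/
def Rep (f : (Fin n → ℂ) → ℂ) (r : ℝ) (c : (Fin n →₀ ℕ) → ℂ) : Prop :=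
  0 < r ∧ Summable (fun α => ‖c α‖ * r ^ α.degree) ∧
    ∀ z, ‖z‖ < r → HasSum (fun α => c α * mon z α) (f z)

lemma Rep.mono {f : (Fin n → ℂ) → ℂ} {r s : ℝ} {c : (Fin n →₀ ℕ) → ℂ} (h : Rep f r c)
    (hs : 0 < s) (hsr : s ≤ r) : Rep f s c := by
  refine ⟨hs, ?_, fun z hz => h.2.2 z (hz.trans_le hsr)⟩
  refine Summable.of_nonneg_of_le (fun α => by positivity) (fun α => ?_) h.2.1
  gcongr

lemma Rep.sub {f g : (Fin n → ℂ) → ℂ} {r s : ℝ} {c d : (Fin n →₀ ℕ) → ℂ} (h : Rep f r c)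
    (h' : Rep g s d) : Rep (fun z => f z - g z) (min r s) (fun α => c α - d α) := by
  have hpos : 0 < min r s := lt_min h.1 h'.1
  have h1 := h.mono hpos (min_le_left _ _)
  have h2 := h'.mono hpos (min_le_right _ _)
  refine ⟨hpos, ?_, fun z hz => ?_⟩
  · refine Summable.of_nonneg_of_le (fun α => by positivity) (fun α => ?_) (h1.2.1.add h2.2.1)
    rw [← add_mul]
    gcongr
    exact norm_sub_le _ _
  · have := (h1.2.2 z hz).sub (h2.2.2 z hz)
    simpa only [sub_mul] using this

lemma Rep.const_mul {f : (Fin n → ℂ) → ℂ} {r : ℝ} {c : (Fin n →₀ ℕ) → ℂ} (h : Rep f r c) (a : ℂ) :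
    Rep (fun z => a * f z) r (fun α => a * c α) := by
  refine ⟨h.1, ?_, fun z hz => ?_⟩
  · simp only [norm_mul, mul_assoc]
    exact h.2.1.mul_left _
  · have := (h.2.2 z hz).mul_left a
    simpa only [mul_assoc] using this

theorem exists_rep {f : (Fin n → ℂ) → ℂ} (hf : AnalyticAt ℂ f 0) : ∃ r c, Rep f r c := by
  obtain ⟨p, R, hp⟩ := hf
  obtain ⟨R', hR'0, hR'⟩ := ENNReal.lt_iff_exists_nnreal_btwn.mp hp.r_pos
  have hR'pos : 0 < R' := by exact_mod_cast hR'0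
  set r : ℝ := R' / (n + 1) with hr
  have hrpos : 0 < r := by positivity
  set a : Wrd n → ℂ := fun w => p w.1 (fun l => Pi.single (w.2 l) 1) with ha
  have hab : ∀ w, ‖a w‖ ≤ ‖p w.1‖ := by
    intro w
    refine ((p w.1).le_opNorm _).trans ?_
    have : ∏ l, ‖(Pi.single (w.2 l) 1 : Fin n → ℂ)‖ = 1 := by
      refine Finset.prod_eq_one fun l _ => ?_
      rw [Pi.norm_single, norm_one]
    rw [this, mul_one]
  have hsum : Summable fun w : Wrd n => ‖a w‖ * r ^ w.1 := by
    have hs := p.summable_norm_mul_pow (hR'.trans_le hp.r_le)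
    rw [summable_sigma_of_nonneg (fun w => by positivity)]
    refine ⟨fun k => (hasSum_fintype _).summable, ?_⟩
    refine Summable.of_nonneg_of_le (fun k => tsum_nonneg fun s => by positivity) (fun k => ?_) hs
    rw [tsum_fintype]
    calc ∑ s : Fin k → Fin n, ‖a ⟨k, s⟩‖ * r ^ k ≤ ∑ s : Fin k → Fin n, ‖p k‖ * r ^ k := by
          gcongr with s
          exact hab ⟨k, s⟩
      _ = (n:ℝ) ^ k * (‖p k‖ * r ^ k) := by simp
      _ = ‖p k‖ * (n * r) ^ k := by rw [mul_pow]; ring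
      _ ≤ ‖p k‖ * R' ^ k := by
          gcongr
          rw [hr, mul_div_assoc', div_le_iff₀ (by positivity)]
          nlinarith [R'.2]
  have hterm : ∀ z : Fin n → ℂ, ∀ w : Wrd n, ‖z‖ ≤ r → ‖a w * mon z (wexp w)‖ ≤ ‖a w‖ * r ^ w.1 := by
    intro z w hz
    rw [norm_mul]
    gcongr
    refine (norm_mon_le _ _).trans ?_
    rw [wexp_degree]
    gcongr
  have hHS : ∀ z : Fin n → ℂ, ‖z‖ < r → HasSum (fun w => a w * mon z (wexp w)) (f z) := by
    intro z hz
    have hsz : Summable fun w => a w * mon z (wexp w) :=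
      Summable.of_norm_bounded hsum (fun w => hterm z w hz.le)
    have h1 := hsz.hasSum.sigma (g := fun k => p k fun _ => z) ?_
    · have hzR : z ∈ Metric.eball (0 : Fin n → ℂ) R := by
        rw [Metric.mem_eball, edist_zero_right]
        refine lt_of_lt_of_le ?_ hR'.le
        rw [enorm_eq_nnnorm]
        norm_cast
        have : r ≤ R' := div_le_self R'.2 (by linarith [n.cast_nonneg (α := ℝ)])
        exact hz.trans_le this
      have h2 := hp.hasSum hzR
      rw [zero_add] at h2
      rw [h2.unique h1]
      exact hsz.hasSum
    · intro k
      have : (p k fun _ => z) = ∑ s : Fin k → Fin n, a ⟨k, s⟩ * mon z (wexp ⟨k, s⟩) := by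
        have hz : (fun _ : Fin k => z) = fun _ : Fin k => ∑ i, z i • (Pi.single i 1 : Fin n → ℂ) := by
          funext l
          exact (pi_eq_sum_univ' z).trans (by simp [Pi.single]) 
        rw [hz, ← ContinuousMultilinearMap.coe_coe, MultilinearMap.map_sum]
        refine Finset.sum_congr rfl fun s _ => ?_
        rw [MultilinearMap.map_smul_univ, mon_wexp, smul_eq_mul, mul_comm]
        rfl
      rw [this]
      exact hasSum_fintype _
  refine ⟨r, fun α => ∑' w : wexp (n := n) ⁻¹' {α}, a w, hrpos, ?_, fun z hz => ?_⟩
  · have h1 := (hsum.hasSum.tsum_fiberwise (wexp (n := n))).summable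
    refine Summable.of_nonneg_of_le (fun α => by positivity) (fun α => ?_) h1
    have heq : ∀ w : wexp (n := n) ⁻¹' {α}, (w : Wrd n).1 = α.degree := fun w => by
      rw [← wexp_degree, w.2]
    have h2 : (∑' w : wexp (n := n) ⁻¹' {α}, ‖a w‖ * r ^ (w : Wrd n).1) =
        (∑' w : wexp (n := n) ⁻¹' {α}, ‖a w‖) * r ^ α.degree := by
      rw [← tsum_mul_right]
      exact tsum_congr fun w => by rw [heq]
    rw [h2]
    gcongr
    refine norm_tsum_le_tsum_norm ?_
    have h3 : Summable fun w : wexp (n := n) ⁻¹' {α} => ‖a w‖ * r ^ (w : Wrd n).1 := hsum.subtype _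
    simp only [heq] at h3
    exact (summable_mul_right_iff (by positivity)).mp h3
  · have h1 := (hHS z hz).tsum_fiberwise (wexp (n := n))
    have h2 : (fun α => (∑' w : wexp (n := n) ⁻¹' {α}, a w) * mon z α) =
        fun α => ∑' w : wexp (n := n) ⁻¹' {α}, a w * mon z (wexp (w : Wrd n)) := by
      funext α
      rw [← tsum_mul_right]
      exact tsum_congr fun w => by rw [w.2]
    rw [h2]
    exact h1

theorem Rep.analyticAt {f : (Fin n → ℂ) → ℂ} {r : ℝ} {c : (Fin n →₀ ℕ) → ℂ} (h : Rep f r c) :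
    AnalyticAt ℂ f 0 := by
  classical
  obtain ⟨hr, hs, hf⟩ := h
  set σ : (Fin n →₀ ℕ) → Wrd n := Function.surjInv wexp_surj with hσ
  have hσe : ∀ α, wexp (σ α) = α := Function.surjInv_eq wexp_surj
  have hσi : Function.Injective σ := Function.injective_surjInv _
  set d : Wrd n → ℂ := fun w => if σ (wexp w) = w then c (wexp w) else 0 with hd
  have hdσ : ∀ α, d (σ α) = c α := fun α => by simp [hd, hσe]
  have hd0 : ∀ w, w ∉ Set.range σ → d w = 0 := by
    intro w hw
    simp only [hd]
    rw [if_neg]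
    intro h
    exact hw ⟨_, h⟩
  have hds : Summable fun w : Wrd n => ‖d w‖ * r ^ w.1 := by
    rw [← hσi.summable_iff (fun w hw => by rw [hd0 w hw]; simp)]
    convert hs using 2 with α
    simp only [Function.comp, hdσ]
    rw [← wexp_degree, hσe]
  have hdf : ∀ z, ‖z‖ < r → HasSum (fun w => d w * mon z (wexp w)) (f z) := by
    intro z hz
    rw [← hσi.hasSum_iff (fun w hw => by rw [hd0 w hw]; simp)]
    convert hf z hz using 2 with α
    simp only [Function.comp, hdσ, hσe]
  set M : (w : Wrd n) → ContinuousMultilinearMap ℂ (fun _ : Fin w.1 => (Fin n → ℂ)) ℂ := fun w =>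
    (ContinuousMultilinearMap.mkPiAlgebra ℂ (Fin w.1) ℂ).compContinuousLinearMap
      (fun l => ContinuousLinearMap.proj (w.2 l)) with hM
  have hMa : ∀ w v, M w v = ∏ l, v l (w.2 l) := by
    intro w v
    simp [hM]
  have hMn : ∀ w, ‖M w‖ ≤ 1 := by
    intro w
    refine ContinuousMultilinearMap.opNorm_le_bound zero_le_one fun v => ?_
    rw [hMa, one_mul, norm_prod]
    exact Finset.prod_le_prod (fun _ _ => norm_nonneg _) fun l _ => norm_le_pi_norm _ _
  set p : FormalMultilinearSeries ℂ (Fin n → ℂ) ℂ := fun k => ∑ s : Fin k → Fin n, d ⟨k, s⟩ • M ⟨k, s⟩ with hp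
  have hpn : ∀ k, ‖p k‖ ≤ ∑ s : Fin k → Fin n, ‖d ⟨k, s⟩‖ := by
    intro k
    refine (norm_sum_le _ _).trans (Finset.sum_le_sum fun s _ => ?_)
    rw [norm_smul]
    exact mul_le_of_le_one_right (norm_nonneg _) (hMn ⟨k, s⟩)
  lift r to NNReal using hr.le
  have hrad : (r : ENNReal) ≤ p.radius := by
    refine p.le_radius_of_summable_norm ?_
    refine Summable.of_nonneg_of_le (fun k => by positivity) (fun k => ?_) hds.sigma
    rw [tsum_fintype]
    change ‖p k‖ * r ^ k ≤ _
    simp only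
    rw [← Finset.sum_mul]
    gcongr
    exact hpn k
  refine ⟨p, _, ⟨hrad, ENNReal.coe_pos.mpr (by exact_mod_cast hr), ?_⟩⟩
  intro y hy
  have hyr : ‖y‖ < r := by
    rw [Metric.mem_eball, edist_zero_right, enorm_eq_nnnorm] at hy
    exact_mod_cast hy
  rw [zero_add]
  refine (hdf y hyr).sigma fun k => ?_
  have : (p k fun _ => y) = ∑ s : Fin k → Fin n, d ⟨k, s⟩ * mon y (wexp ⟨k, s⟩) := by
    simp only [hp, ContinuousMultilinearMap.sum_apply, ContinuousMultilinearMap.smul_apply, hMa, mon_wexp,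
      smul_eq_mul]
  rw [this]
  exact hasSum_fintype _

end series
end JacAux


namespace JacAux
open MvPolynomial Filter Asymptotics
open scoped Topology

section trunc
variable {n : ℕ}

lemma finite_deg (L : ℕ) : {α : Fin n →₀ ℕ | α.degree < L}.Finite :=
  Finsupp.finite_of_degree_lt L

/-- truncation -/
noncomputable def trunc (c : (Fin n →₀ ℕ) → ℂ) (L : ℕ) : MvPolynomial (Fin n) ℂ :=
  ∑ α ∈ (finite_deg (n := n) L).toFinset, monomial α (c α)

lemma coeff_trunc (c : (Fin n →₀ ℕ) → ℂ) (L : ℕ) (β : Fin n →₀ ℕ) (h : β.degree < L) :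
    coeff β (trunc c L) = c β := by
  classical
  unfold trunc
  rw [coeff_sum]
  simp only [coeff_monomial]
  rw [Finset.sum_ite_eq', if_pos]
  simpa using h

lemma trunc_mem (c : (Fin n →₀ ℕ) → ℂ) (L : ℕ) : trunc c L ∈ Wd (Fin n) L := by
  refine Submodule.sum_mem _ fun α hα => monomial_mem_Wd ?_ _
  simpa using hα

lemma eval_trunc (c : (Fin n →₀ ℕ) → ℂ) (L : ℕ) (z : Fin n → ℂ) :
    eval z (trunc c L) = ∑ α ∈ (finite_deg (n := n) L).toFinset, c α * mon z α := by
  unfold trunc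
  rw [map_sum]
  exact Finset.sum_congr rfl fun α _ => by rw [eval_monomial]; rfl

lemma Rep.trunc_bound {f : (Fin n → ℂ) → ℂ} {r : ℝ} {c : (Fin n →₀ ℕ) → ℂ} (h : Rep f r c) (L : ℕ)
    (z : Fin n → ℂ) (hz : ‖z‖ < r) :
    ‖f z - eval z (trunc c L)‖ ≤ (‖z‖ / r) ^ L * ∑' α, ‖c α‖ * r ^ α.degree := by
  classical
  obtain ⟨hr, hs, hf⟩ := h
  set F := (finite_deg (n := n) L).toFinset with hF
  have h1 : HasSum (fun α => if α ∈ F then c α * mon z α else 0) (eval z (trunc c L)) := by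
    rw [eval_trunc]
    have := hasSum_sum_of_ne_finset_zero (L := SummationFilter.unconditional _) (f := fun α => if α ∈ F then c α * mon z α else 0) (s := F)
      (fun b hb => if_neg hb)
    convert this using 1
    exact Finset.sum_congr rfl fun α hα => (if_pos hα).symm
  have h2 := (hf z hz).sub h1
  refine h2.norm_le_of_bounded (hs.hasSum.mul_left _) fun α => ?_
  split_ifs with hα
  · rw [sub_self, norm_zero]; positivity
  · rw [sub_zero, norm_mul]
    have hd : L ≤ α.degree := by simpa [hF] using hα
    calc ‖c α‖ * ‖mon z α‖ ≤ ‖c α‖ * ‖z‖ ^ α.degree := by gcongr; exact norm_mon_le _ _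
      _ = ‖c α‖ * ((‖z‖ / r) ^ α.degree * r ^ α.degree) := by
          rw [← mul_pow, div_mul_cancel₀ _ hr.ne']
      _ ≤ ‖c α‖ * ((‖z‖ / r) ^ L * r ^ α.degree) := by
          gcongr ‖c α‖ * (?_ * _)
          exact pow_le_pow_of_le_one (by positivity) ((div_le_one hr).mpr hz.le) hd
      _ = _ := by ring

lemma Rep.trunc_isBigO {f : (Fin n → ℂ) → ℂ} {r : ℝ} {c : (Fin n →₀ ℕ) → ℂ} (h : Rep f r c) (L : ℕ) :
    (fun z => f z - eval z (trunc c L)) =O[𝓝 0] fun z => ‖z‖ ^ L := by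
  refine IsBigO.of_bound ((1/r)^L * ∑' α, ‖c α‖ * r ^ α.degree) ?_
  filter_upwards [Metric.ball_mem_nhds (0 : Fin n → ℂ) h.1] with z hz
  rw [mem_ball_zero_iff] at hz
  refine (h.trunc_bound L z hz).trans (le_of_eq ?_)
  rw [norm_pow, norm_norm, div_pow, div_pow]
  ring

lemma poly_zero_of_isBigO {q : Polynomial ℂ} {K : ℕ} (hq : q.natDegree < K)
    (h : (fun t : ℂ => q.eval t) =O[𝓝 0] fun t => ‖t‖ ^ K) : q = 0 := by
  by_contra hne
  obtain ⟨s, hs, hdiv⟩ := Polynomial.exists_eq_pow_rootMultiplicity_mul_and_not_dvd q hne 0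
  set j := q.rootMultiplicity 0 with hj
  have hs0 : s.eval 0 ≠ 0 := fun h0 => hdiv (Polynomial.dvd_iff_isRoot.mpr h0)
  have hjd : j ≤ q.natDegree := by
    conv_rhs => rw [hs]
    have hs' : s ≠ 0 := by rintro rfl; simp at hs0
    rw [Polynomial.natDegree_mul (pow_ne_zero _ (Polynomial.X_sub_C_ne_zero 0)) hs',
      Polynomial.natDegree_pow, Polynomial.natDegree_X_sub_C]
    omega
  have hev : ∀ t, q.eval t = t ^ j * s.eval t := by
    intro t
    conv_lhs => rw [hs]
    simp
  obtain ⟨C, hC⟩ := h.bound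
  have hlim : Tendsto (fun t : ℂ => C * ‖t‖) (𝓝[≠] 0) (𝓝 0) := by
    have : Tendsto (fun t : ℂ => C * ‖t‖) (𝓝 0) (𝓝 (C * ‖(0:ℂ)‖)) :=
      (continuous_const.mul continuous_norm).continuousAt
    rw [norm_zero, mul_zero] at this
    exact this.mono_left nhdsWithin_le_nhds
  have hle : ∀ᶠ t : ℂ in 𝓝[≠] 0, ‖s.eval t‖ ≤ C * ‖t‖ := by
    have hb : ∀ᶠ t : ℂ in 𝓝[≠] 0, t ∈ Metric.ball (0:ℂ) 1 :=
      nhdsWithin_le_nhds (Metric.ball_mem_nhds _ one_pos)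
    filter_upwards [nhdsWithin_le_nhds hC, self_mem_nhdsWithin, hb] with t ht ht0 ht1
    have ht0' : 0 < ‖t‖ := norm_pos_iff.mpr ht0
    rw [mem_ball_zero_iff] at ht1
    rw [hev, norm_mul, norm_pow, norm_pow, norm_norm] at ht
    have hC0 : 0 ≤ C := by
      by_contra hneg
      push Not at hneg
      have h1 : 0 ≤ ‖t‖ ^ j * ‖s.eval t‖ := by positivity
      have h2 : 0 < ‖t‖ ^ K := by positivity
      nlinarith
    have h3 : ‖t‖ ^ K ≤ ‖t‖ ^ j * ‖t‖ := by
      rw [← pow_succ]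
      exact pow_le_pow_of_le_one ht0'.le ht1.le (by omega)
    have h4 : ‖t‖ ^ j * ‖s.eval t‖ ≤ ‖t‖ ^ j * (C * ‖t‖) := by
      calc _ ≤ C * ‖t‖ ^ K := ht
        _ ≤ C * (‖t‖ ^ j * ‖t‖) := by gcongr
        _ = _ := by ring
    exact le_of_mul_le_mul_left h4 (by positivity)
  have h5 : Tendsto (fun t : ℂ => ‖s.eval t‖) (𝓝[≠] 0) (𝓝 ‖s.eval 0‖) :=
    (s.continuous.norm.continuousAt.tendsto).mono_left nhdsWithin_le_nhds
  have h6 := le_of_tendsto_of_tendsto h5 hlim hle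
  exact hs0 (norm_le_zero_iff.mp h6)

lemma mvpoly_zero_of_isBigO {p : MvPolynomial (Fin n) ℂ} {K : ℕ} (hp : p ∈ Wd (Fin n) K)
    (h : (fun z => eval z p) =O[𝓝 0] fun z => ‖z‖ ^ K) : p = 0 := by
  rcases Nat.eq_zero_or_pos K with rfl | hK
  · exact Wd_zero hp
  refine MvPolynomial.funext fun z => ?_
  rw [map_zero]
  set q : Polynomial ℂ := aeval (fun i => Polynomial.C (z i) * Polynomial.X) p with hq
  have hev : ∀ t, q.eval t = eval (t • z) p := by
    intro t
    rw [hq, ← Polynomial.coe_aeval_eq_eval, MvPolynomial.comp_aeval_apply, aeval_eq_eval]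
    have : (fun i => Polynomial.aeval t (Polynomial.C (z i) * Polynomial.X)) = t • z := by
      ext i
      rw [Polynomial.coe_aeval_eq_eval, Polynomial.eval_mul, Polynomial.eval_C, Polynomial.eval_X,
        Pi.smul_apply, smul_eq_mul, mul_comm]
    rw [this]
  have hdeg : q.natDegree < K := by
    rw [hq, aeval_def, eval₂_eq]
    refine lt_of_le_of_lt (Polynomial.natDegree_sum_le_of_forall_le (n := K - 1) _ _ fun γ hγ => ?_) (by omega)
    have h1 := mem_Wd.mp hp γ hγ
    have h2 : ∏ i ∈ γ.support, (Polynomial.C (z i) * Polynomial.X : Polynomial ℂ) ^ γ i =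
        Polynomial.C (∏ i ∈ γ.support, z i ^ γ i) * Polynomial.X ^ γ.degree := by
      simp only [mul_pow, Finset.prod_mul_distrib, map_prod, map_pow]
      congr 1
      rw [Finset.prod_pow_eq_pow_sum]
      rfl
    rw [h2, ← mul_assoc]
    change (Polynomial.C (coeff γ p) * _ * _).natDegree ≤ _
    rw [← map_mul]
    exact (Polynomial.natDegree_C_mul_X_pow_le _ _).trans (by omega)
  have h3 : q = 0 := by
    refine poly_zero_of_isBigO hdeg ?_
    have ht : Tendsto (fun t : ℂ => t • z) (𝓝 0) (𝓝 0) := by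
      have : Tendsto (fun t : ℂ => t • z) (𝓝 0) (𝓝 ((0:ℂ) • z)) :=
        (continuous_id.smul continuous_const).continuousAt
      rwa [zero_smul] at this
    have h4 := h.comp_tendsto ht
    simp only [Function.comp_def, ← hev] at h4
    refine h4.trans (IsBigO.of_bound (‖z‖ ^ K) (Eventually.of_forall fun t => ?_))
    simp only [norm_smul, norm_pow, norm_mul, norm_norm, mul_pow]
    rw [mul_comm]
  have := hev 1
  rw [h3, one_smul] at this
  simpa using this.symm

lemma Rep.coeff_zero {f : (Fin n → ℂ) → ℂ} {r : ℝ} {c : (Fin n →₀ ℕ) → ℂ} (h : Rep f r c) {K : ℕ}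
    (hO : f =O[𝓝 0] fun z => ‖z‖ ^ K) (α : Fin n →₀ ℕ) (hα : α.degree < K) : c α = 0 := by
  have h1 := h.trunc_isBigO K
  have h2 := hO.sub h1
  simp only [sub_sub_cancel] at h2
  have h3 := mvpoly_zero_of_isBigO (trunc_mem c K) h2
  rw [← coeff_trunc c K α hα, h3, MvPolynomial.coeff_zero]

end trunc
end JacAux


namespace JacAux
open MvPolynomial Filter Asymptotics
open scoped Topology

section ell1
variable {n : ℕ}

/-- the Banach space of summable families of coefficients -/
noncomputable abbrev XX (n : ℕ) := lp (fun _ : Fin n →₀ ℕ => ℂ) 1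

/-- basis vector -/
noncomputable def ee (β : Fin n →₀ ℕ) : XX n := lp.single 1 β (1:ℂ)

lemma norm_ee (β : Fin n →₀ ℕ) : ‖ee β‖ = 1 := by
  unfold ee
  rw [lp.norm_single one_pos, norm_one]

lemma hasSum_norm_XX (x : XX n) : HasSum (fun β => ‖x β‖) ‖x‖ := by
  have := lp.hasSum_norm (p := 1) (by simp) x
  simpa using this

lemma norm_XX (x : XX n) : ‖x‖ = ∑' β, ‖x β‖ := (hasSum_norm_XX x).tsum_eq.symm

/-- build an element -/
noncomputable def mkX (x : (Fin n →₀ ℕ) → ℂ) (h : Summable fun β => ‖x β‖) : XX n :=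
  ⟨x, memℓp_gen (by simpa using h)⟩

lemma mkX_apply (x : (Fin n →₀ ℕ) → ℂ) (h : Summable fun β => ‖x β‖) (β : Fin n →₀ ℕ) :
    mkX x h β = x β := rfl

lemma ee_apply (β γ : Fin n →₀ ℕ) : ee β γ = if γ = β then (1:ℂ) else 0 := by
  unfold ee
  split_ifs with h
  · subst h; exact lp.single_apply_self _ _ _
  · exact lp.single_apply_ne _ _ _ h

lemma hasSum_ee (x : XX n) : HasSum (fun β => x β • ee β) x := by
  have := lp.hasSum_single (E := fun _ : Fin n →₀ ℕ => ℂ) ENNReal.one_ne_top x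
  convert this using 2 with β
  unfold ee
  rw [← lp.single_smul, smul_eq_mul, mul_one]

variable {Y : Type*} [NormedAddCommGroup Y] [NormedSpace ℂ Y] [CompleteSpace Y]

lemma summable_LL {v : (Fin n →₀ ℕ) → Y} {C : ℝ} (hv : ∀ β, ‖v β‖ ≤ C) (x : XX n) :
    Summable fun β => ‖x β • v β‖ := by
  refine Summable.of_nonneg_of_le (fun _ => norm_nonneg _) (fun β => ?_)
    ((hasSum_norm_XX x).summable.mul_right C)
  rw [norm_smul]
  gcongr
  exact hv β

/-- the continuous linear map with prescribed values on the basis -/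
noncomputable def LL (v : (Fin n →₀ ℕ) → Y) (C : ℝ) (hv : ∀ β, ‖v β‖ ≤ C) : XX n →L[ℂ] Y :=
  LinearMap.mkContinuous
    { toFun := fun x => ∑' β, x β • v β
      map_add' := fun x y => by
        rw [← (summable_LL hv x).of_norm.tsum_add (summable_LL hv y).of_norm]
        exact tsum_congr fun β => by rw [lp.coeFn_add, Pi.add_apply, add_smul]
      map_smul' := fun c x => by
        rw [RingHom.id_apply, ← (summable_LL hv x).of_norm.tsum_const_smul]
        exact tsum_congr fun β => by rw [lp.coeFn_smul, Pi.smul_apply, smul_assoc] } C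
    (fun x => by
      change ‖∑' β, x β • v β‖ ≤ _
      refine tsum_of_norm_bounded ((hasSum_norm_XX x).mul_left C) fun β => ?_
      rw [norm_smul, mul_comm]
      gcongr
      exact hv β)

lemma LL_apply (v : (Fin n →₀ ℕ) → Y) (C : ℝ) (hv : ∀ β, ‖v β‖ ≤ C) (x : XX n) :
    LL v C hv x = ∑' β, x β • v β := rfl

lemma LL_ee (v : (Fin n →₀ ℕ) → Y) (C : ℝ) (hv : ∀ β, ‖v β‖ ≤ C) (β : Fin n →₀ ℕ) :
    LL v C hv (ee β) = v β := by
  rw [LL_apply, tsum_eq_single β]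
  · rw [ee_apply, if_pos rfl, one_smul]
  · intro γ hγ
    rw [ee_apply, if_neg hγ, zero_smul]

lemma LL_norm (v : (Fin n →₀ ℕ) → Y) (C : ℝ) (hv : ∀ β, ‖v β‖ ≤ C) (hC : 0 ≤ C) :
    ‖LL v C hv‖ ≤ C := LinearMap.mkContinuous_norm_le _ hC _

lemma ext_ee {A B : XX n →L[ℂ] Y} (h : ∀ β, A (ee β) = B (ee β)) : A = B := by
  ext x
  have h1 := (hasSum_ee x).mapL A
  have h2 := (hasSum_ee x).mapL B
  simp only [map_smul, h] at h1 h2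
  exact h1.unique h2

/-- evaluation -/
noncomputable def ev (u : Fin n → ℂ) (hu : ‖u‖ ≤ 1) : XX n →L[ℂ] ℂ :=
  LL (fun β => mon u β) 1 (fun β => (norm_mon_le u β).trans (pow_le_one₀ (norm_nonneg _) hu))

lemma ev_ee (u : Fin n → ℂ) (hu : ‖u‖ ≤ 1) (β : Fin n →₀ ℕ) : ev u hu (ee β) = mon u β := LL_ee _ _ _ _

lemma ev_apply (u : Fin n → ℂ) (hu : ‖u‖ ≤ 1) (x : XX n) : ev u hu x = ∑' β, x β * mon u β := rfl

lemma ev_hasSum (u : Fin n → ℂ) (hu : ‖u‖ ≤ 1) (x : XX n) :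
    HasSum (fun β => x β * mon u β) (ev u hu x) :=
  (summable_LL (v := fun β => mon u β) (C := 1) (fun β => (norm_mon_le u β).trans
    (pow_le_one₀ (norm_nonneg _) hu)) x).of_norm.hasSum

/-- shift -/
noncomputable def Sh (γ : Fin n →₀ ℕ) : XX n →L[ℂ] XX n :=
  LL (fun β => ee (β + γ)) 1 (fun β => (norm_ee _).le)

lemma Sh_ee (γ β : Fin n →₀ ℕ) : Sh γ (ee β) = ee (β + γ) := LL_ee _ _ _ _

lemma Sh_norm_le (γ : Fin n →₀ ℕ) (x : XX n) : ‖Sh γ x‖ ≤ ‖x‖ := by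
  refine ((Sh γ).le_opNorm x).trans ?_
  exact mul_le_of_le_one_left (norm_nonneg _) (LL_norm _ _ _ zero_le_one)

lemma ev_Sh (u : Fin n → ℂ) (hu : ‖u‖ ≤ 1) (γ : Fin n →₀ ℕ) (x : XX n) :
    ev u hu (Sh γ x) = mon u γ * ev u hu x := by
  have : (ev u hu).comp (Sh γ) = mon u γ • ev u hu := by
    refine ext_ee fun β => ?_
    simp only [ContinuousLinearMap.comp_apply, Sh_ee, ev_ee, ContinuousLinearMap.smul_apply, mon_add,
      smul_eq_mul]
    ring
  have h2 := DFunLike.congr_fun this x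
  simpa using h2

/-- Division in `ℓ¹`: -/
theorem ell1_division {m : ℕ} (α : Fin m → (Fin n →₀ ℕ)) (g : Fin m → XX n)
    (hg : ∀ i, ‖g i - ee (α i)‖ ≤ 1/2) (h : XX n) :
    ∃ (y : Fin m → XX n) (r : XX n), (∀ i β, α i ≤ β → r β = 0) ∧
      ∀ u hu, ev u hu h = ∑ i, ev u hu (y i) * ev u hu (g i) + ev u hu r := by
  classical
  -- index
  have hidx : ∀ β : Fin n →₀ ℕ, ∃ o : Option (Fin m), (∀ i, o = some i → α i ≤ β) ∧
      (o = none → ∀ i, ¬ α i ≤ β) := by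
    intro β
    by_cases h : ∃ i, α i ≤ β
    · obtain ⟨i, hi⟩ := h
      exact ⟨some i, fun j hj => by cases hj; exact hi, fun h => by simp at h⟩
    · have h' : ∀ i, ¬ α i ≤ β := fun i hi => h ⟨i, hi⟩
      exact ⟨none, fun i hi => by simp at hi, fun _ => h'⟩
  choose o ho1 ho2 using hidx
  set v : (Fin n →₀ ℕ) → XX n := fun β => match o β with
    | some i => Sh (β - α i) (g i)
    | none => ee β with hv
  have hvs : ∀ β i, o β = some i → v β = Sh (β - α i) (g i) := by
    intro β i hi
    simp only [hv, hi]
  have hvn : ∀ β, o β = none → v β = ee β := by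
    intro β hi
    simp only [hv, hi]
  have hve : ∀ β, ‖ee β - v β‖ ≤ 1/2 := by
    intro β
    rcases hoβ : o β with _ | i
    · rw [hvn β hoβ, sub_self, norm_zero]; norm_num
    · rw [hvs β i hoβ]
      have : ee β = Sh (β - α i) (ee (α i)) := by
        rw [Sh_ee, add_tsub_cancel_of_le (ho1 β i hoβ)]
      rw [this, ← map_sub]
      refine (Sh_norm_le _ _).trans ?_
      rw [norm_sub_rev]
      exact hg i
  set Ψ : XX n →L[ℂ] XX n := LL (fun β => ee β - v β) (1/2) hve with hΨ
  have hΨn : ‖Ψ‖ < 1 := lt_of_le_of_lt (LL_norm _ _ _ (by norm_num)) (by norm_num)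
  have hunit := isUnit_one_sub_of_norm_lt_one hΨn
  obtain ⟨x, hx⟩ : ∃ x, (1 - Ψ) x = h := by
    obtain ⟨w, hw⟩ := hunit.exists_right_inv
    refine ⟨w h, ?_⟩
    have := DFunLike.congr_fun hw h
    simpa using this
  set Yi : Fin m → (XX n →L[ℂ] XX n) := fun i =>
    LL (fun β => if o β = some i then ee (β - α i) else 0) 1 (fun β => by
      split_ifs
      · exact (norm_ee _).le
      · rw [norm_zero]; exact zero_le_one) with hYi
  set R : XX n →L[ℂ] XX n :=
    LL (fun β => if o β = none then ee β else 0) 1 (fun β => by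
      split_ifs
      · exact (norm_ee _).le
      · rw [norm_zero]; exact zero_le_one) with hR
  refine ⟨fun i => Yi i x, R x, ?_, ?_⟩
  · intro i β hiβ
    rw [hR, LL_apply]
    have hs := (summable_LL (v := fun β => if o β = none then (ee β : XX n) else 0) (C := 1) (fun β => by
      split_ifs
      · exact (norm_ee _).le
      · rw [norm_zero]; exact zero_le_one) x).of_norm.hasSum
    have hcoord := hs.mapL (lp.evalCLM ℂ (fun _ : Fin n →₀ ℕ => ℂ) 1 β)
    refine hcoord.unique ?_
    convert hasSum_zero using 2 with γ
    change (x γ • (if o γ = none then (ee γ : XX n) else 0)) β = 0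
    rw [lp.coeFn_smul, Pi.smul_apply]
    split_ifs with hγ
    · rw [ee_apply, if_neg, smul_zero]
      rintro rfl
      exact ho2 _ hγ i hiβ
    · simp
  · intro u hu
    rw [← hx]
    have : (ev u hu).comp (1 - Ψ) = ∑ i, (ev u hu (g i)) • (ev u hu).comp (Yi i) + (ev u hu).comp R := by
      refine ext_ee fun β => ?_
      simp only [ContinuousLinearMap.comp_apply, ContinuousLinearMap.sub_apply,
        ContinuousLinearMap.add_apply, ContinuousLinearMap.sum_apply,
        ContinuousLinearMap.smul_apply, ContinuousLinearMap.one_apply, hΨ, hYi, hR, LL_ee, sub_sub_cancel]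
      rcases hoβ : o β with _ | i
      · rw [hvn β hoβ]
        simp
      · rw [hvs β i hoβ, ev_Sh]
        simp [apply_ite (ev u hu), ev_ee, mul_comm]
    have h2 := DFunLike.congr_fun this x
    rw [ContinuousLinearMap.comp_apply] at h2
    rw [h2]
    simp [mul_comm]

end ell1
end JacAux


namespace JacAux
open MvPolynomial Filter Asymptotics
open scoped Topology

section scaling
variable {n : ℕ}

/-- distinct primes -/
noncomputable def pr (i : Fin n) : ℕ := Nat.nth Nat.Prime i

lemma pr_prime (i : Fin n) : (pr i).Prime := Nat.prime_nth_prime _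

lemma pr_inj : Function.Injective (pr (n := n)) := fun _ _ h =>
  Fin.ext (Nat.nth_injective Nat.infinite_setOf_prime h)

/-- weight of an exponent -/
noncomputable def NN (α : Fin n →₀ ℕ) : ℕ := α.prod fun i k => pr i ^ k

lemma NN_add (α β : Fin n →₀ ℕ) : NN (α + β) = NN α * NN β := by
  unfold NN
  exact Finsupp.prod_add_index' (fun _ => pow_zero _) (fun _ _ _ => pow_add _ _ _)

lemma NN_single (i : Fin n) (k : ℕ) : NN (Finsupp.single i k) = pr i ^ k := by
  unfold NN
  exact Finsupp.prod_single_index (pow_zero _)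

lemma NN_zero : NN (0 : Fin n →₀ ℕ) = 1 := by simp [NN]

lemma two_pow_le_NN (α : Fin n →₀ ℕ) : 2 ^ α.degree ≤ NN α := by
  induction α using Finsupp.induction_linear with
  | zero => simp [NN_zero]
  | add f g hf hg =>
    rw [NN_add, map_add, pow_add]
    gcongr
  | single i k =>
    rw [NN_single, Finsupp.degree_single]
    gcongr
    exact (pr_prime i).two_le

lemma NN_pos (α : Fin n →₀ ℕ) : 0 < NN α := lt_of_lt_of_le (by positivity) (two_pow_le_NN α)

lemma NN_fact (α : Fin n →₀ ℕ) (j : Fin n) : (NN α).factorization (pr j) = α j := by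
  induction α using Finsupp.induction_linear with
  | zero => simp [NN_zero]
  | add f g hf hg =>
    rw [NN_add, Nat.factorization_mul (NN_pos f).ne' (NN_pos g).ne', Finsupp.add_apply, Finsupp.add_apply, hf, hg]
  | single i k =>
    rw [NN_single, Nat.factorization_pow, (pr_prime i).factorization]
    by_cases h : i = j
    · subst h; simp
    · have : pr i ≠ pr j := fun h' => h (pr_inj h')
      simp [Finsupp.single_apply, h, this]

lemma NN_inj : Function.Injective (NN (n := n)) := by
  intro α β h
  ext j
  rw [← NN_fact, h, NN_fact]

/-- scaling of coordinates -/
noncomputable def sc (T : ℕ) (z : Fin n → ℂ) : Fin n → ℂ := fun i => (pr i : ℂ) ^ T * z i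

lemma mon_sc (T : ℕ) (z : Fin n → ℂ) (β : Fin n →₀ ℕ) : mon (sc T z) β = (NN β : ℂ) ^ T * mon z β := by
  induction β using Finsupp.induction_linear with
  | zero => simp [NN_zero, mon_zero]
  | add f g hf hg =>
    rw [NN_add, mon_add, mon_add, hf, hg]
    push_cast
    ring
  | single i k =>
    rw [NN_single, mon_single, mon_single, sc]
    push_cast
    ring

lemma norm_of_sc {T : ℕ} {z : Fin n → ℂ} (hz : ‖sc T z‖ ≤ 1) : ‖z‖ ≤ (1/2)^T := by
  rw [pi_norm_le_iff_of_nonneg (by positivity)]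
  intro i
  have h1 : ‖sc T z i‖ ≤ 1 := (norm_le_pi_norm _ i).trans hz
  rw [sc, norm_mul, norm_pow, Complex.norm_natCast] at h1
  have h2 : (2:ℝ) ≤ pr i := by exact_mod_cast (pr_prime i).two_le
  have h3 : (2:ℝ) ^ T * ‖z i‖ ≤ 1 := by
    refine le_trans ?_ h1
    gcongr
  rw [one_div, inv_pow, ← one_div, le_div_iff₀ (by positivity), mul_comm]
  exact h3

lemma scaled_bound (T : ℕ) {r : ℝ} (hr : (1/2:ℝ)^T ≤ r) (β : Fin n →₀ ℕ) :
    ((NN β : ℝ) ^ T)⁻¹ ≤ r ^ β.degree := by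
  have h1 : (2:ℝ) ^ β.degree ≤ NN β := by exact_mod_cast two_pow_le_NN β
  calc ((NN β : ℝ) ^ T)⁻¹ ≤ (((2:ℝ) ^ β.degree) ^ T)⁻¹ := by gcongr
    _ = ((1/2:ℝ)^T)^β.degree := by
        rw [one_div, inv_pow, inv_pow, ← pow_mul, ← pow_mul, mul_comm]
    _ ≤ _ := by gcongr

lemma scaled {f : (Fin n → ℂ) → ℂ} {r : ℝ} {c : (Fin n →₀ ℕ) → ℂ} (h : Rep f r c) :
    ∃ T0, ∀ T ≥ T0, ∃ x : XX n, (∀ β, x β = c β / (NN β : ℂ) ^ T) ∧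
      ∀ z (hz : ‖sc T z‖ ≤ 1), ev (sc T z) hz x = f z := by
  obtain ⟨T0, hT0⟩ := exists_pow_lt_of_lt_one h.1 (show (1/2:ℝ) < 1 by norm_num)
  refine ⟨T0, fun T hT => ?_⟩
  have hTr : (1/2:ℝ)^T < r := (pow_le_pow_of_le_one (by norm_num) (by norm_num) hT).trans_lt hT0
  have hs : Summable fun β => ‖c β / (NN β : ℂ) ^ T‖ := by
    refine Summable.of_nonneg_of_le (fun _ => norm_nonneg _) (fun β => ?_) h.2.1
    rw [norm_div, norm_pow, Complex.norm_natCast, div_eq_mul_inv]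
    gcongr
    exact scaled_bound T hTr.le β
  refine ⟨mkX _ hs, fun β => rfl, fun z hz => ?_⟩
  have h1 := ev_hasSum (sc T z) hz (mkX _ hs)
  refine h1.unique ?_
  have h2 := h.2.2 z ((norm_of_sc hz).trans_lt hTr)
  convert h2 using 2 with β
  rw [mkX_apply, mon_sc]
  have : (NN β : ℂ) ^ T ≠ 0 := pow_ne_zero _ (by exact_mod_cast (NN_pos β).ne')
  field_simp

lemma scaled_lead {f : (Fin n → ℂ) → ℂ} {r : ℝ} {c : (Fin n →₀ ℕ) → ℂ} (h : Rep f r c)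
    {α : Fin n →₀ ℕ} (hα : c α = 1) (hlead : ∀ β, c β ≠ 0 → NN α ≤ NN β) :
    ∃ T0, ∀ T ≥ T0, ∃ x : XX n, ‖x - ee α‖ ≤ 1/2 ∧
      ∀ z (hz : ‖sc T z‖ ≤ 1), ev (sc T z) hz x = (NN α : ℂ) ^ T * f z := by
  obtain ⟨T0, hT0⟩ := scaled h
  obtain ⟨x0, hx0, -⟩ := hT0 T0 le_rfl
  set q : ℝ := NN α / (NN α + 1) with hq
  have hNα : (0:ℝ) < NN α := by exact_mod_cast NN_pos α
  have hq0 : 0 ≤ q := by positivity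
  have hq1 : q < 1 := by rw [hq, div_lt_one (by positivity)]; linarith
  set B : ℝ := (NN α : ℝ) ^ T0 * ‖x0‖ with hB
  have hB0 : 0 ≤ B := by positivity
  obtain ⟨S, hS⟩ := exists_pow_lt_of_lt_one (show (0:ℝ) < 1 / (2 * (B + 1)) by positivity) hq1
  refine ⟨T0 + S, fun T hT => ?_⟩
  obtain ⟨x, hx, hxf⟩ := hT0 T (by omega)
  refine ⟨((NN α : ℂ) ^ T) • x, ?_, fun z hz => by rw [map_smul, hxf, smul_eq_mul]⟩
  have key : ∀ β, ‖(((NN α : ℂ) ^ T) • x - ee α) β‖ ≤ q ^ S * (NN α : ℝ) ^ T0 * ‖x0 β‖ := by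
    intro β
    have hNβ : (0:ℝ) < NN β := by exact_mod_cast NN_pos β
    have e1 : (((NN α : ℂ) ^ T) • x - ee α) β = (NN α : ℂ) ^ T * (c β / (NN β : ℂ) ^ T) - ee α β := by
      rw [lp.coeFn_sub, Pi.sub_apply, lp.coeFn_smul, Pi.smul_apply, hx, smul_eq_mul]
    rw [e1, ee_apply]
    by_cases hβ : β = α
    · subst hβ
      rw [if_pos rfl, hα]
      have : (NN β : ℂ) ^ T ≠ 0 := pow_ne_zero _ (by exact_mod_cast (NN_pos β).ne')
      rw [mul_one_div_cancel this, sub_self, norm_zero]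
      positivity
    rw [if_neg hβ, sub_zero, hx0]
    by_cases hc : c β = 0
    · rw [hc]; simp
    have hlt : (NN α : ℝ) + 1 ≤ NN β := by
      have : NN α < NN β := lt_of_le_of_ne (hlead β hc) fun h' => hβ (NN_inj h').symm
      exact_mod_cast this
    rw [norm_mul, norm_div, norm_div, norm_pow, norm_pow, norm_pow, Complex.norm_natCast, Complex.norm_natCast]
    have hρ : (NN α : ℝ) / NN β ≤ q := by rw [hq]; gcongr
    obtain ⟨k, rfl⟩ := Nat.exists_eq_add_of_le hT
    calc (NN α : ℝ) ^ (T0 + S + k) * (‖c β‖ / (NN β : ℝ) ^ (T0 + S + k))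
        = ((NN α : ℝ) / NN β) ^ S * ((NN α : ℝ) / NN β) ^ k * ((NN α : ℝ) ^ T0 * (‖c β‖ / (NN β : ℝ) ^ T0)) := by
          rw [div_pow, div_pow, pow_add, pow_add, pow_add, pow_add]
          field_simp
      _ ≤ q ^ S * 1 * ((NN α : ℝ) ^ T0 * (‖c β‖ / (NN β : ℝ) ^ T0)) := by
          gcongr
          exact pow_le_one₀ (by positivity) (hρ.trans hq1.le)
      _ = _ := by ring
  rw [norm_XX]
  have h1 : ∑' β, ‖(((NN α : ℂ) ^ T) • x - ee α) β‖ ≤ q ^ S * (NN α : ℝ) ^ T0 * ‖x0‖ :=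
    hasSum_le key (hasSum_norm_XX _).summable.hasSum ((hasSum_norm_XX x0).mul_left _)
  refine h1.trans ?_
  rw [mul_assoc, ← hB]
  calc q ^ S * B ≤ 1 / (2 * (B + 1)) * (B + 1) := by
        gcongr
        linarith
    _ = 1/2 := by field_simp

/-- the function attached to an element of the Banach space -/
noncomputable def evz (T : ℕ) (x : XX n) (z : Fin n → ℂ) : ℂ := ∑' β, x β * mon (sc T z) β

lemma exists_sc_small (T : ℕ) : ∃ s : ℝ, 0 < s ∧ ∀ z : Fin n → ℂ, ‖z‖ ≤ s → ‖sc T z‖ ≤ 1 := by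
  refine ⟨((∏ i : Fin n, (pr i : ℝ)) ^ T)⁻¹, ?_, fun z hz => ?_⟩
  · have : 0 < ∏ i : Fin n, (pr i : ℝ) := Finset.prod_pos fun i _ => by exact_mod_cast (pr_prime i).pos
    positivity
  · rw [pi_norm_le_iff_of_nonneg zero_le_one]
    intro i
    have hpos : 0 < ∏ i : Fin n, (pr i : ℝ) := Finset.prod_pos fun i _ => by exact_mod_cast (pr_prime i).pos
    have hle : (pr i : ℝ) ≤ ∏ i : Fin n, (pr i : ℝ) := by
      have := Nat.le_of_dvd (Finset.prod_pos fun i _ => (pr_prime (n := n) i).pos)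
        (Finset.dvd_prod_of_mem (fun i : Fin n => pr i) (Finset.mem_univ i))
      exact_mod_cast this
    rw [sc, norm_mul, norm_pow, Complex.norm_natCast]
    calc (pr i : ℝ) ^ T * ‖z i‖ ≤ (∏ i : Fin n, (pr i : ℝ)) ^ T * ((∏ i : Fin n, (pr i : ℝ)) ^ T)⁻¹ := by
          gcongr
          exact (norm_le_pi_norm z i).trans hz
      _ = 1 := mul_inv_cancel₀ (by positivity)

lemma evz_rep (T : ℕ) (x : XX n) : ∃ s, Rep (evz T x) s (fun β => x β * (NN β : ℂ) ^ T) := by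
  obtain ⟨s, hs, hsc⟩ := exists_sc_small (n := n) T
  refine ⟨s, hs, ?_, fun z hz => ?_⟩
  · refine Summable.of_nonneg_of_le (fun _ => by positivity) (fun β => ?_) (hasSum_norm_XX x).summable
    have h1 : mon (fun _ : Fin n => (s:ℂ)) β = (s:ℂ) ^ β.degree := by
      induction β using Finsupp.induction_linear with
      | zero => simp [mon_zero]
      | add f g hf hg => rw [mon_add, hf, hg, map_add, pow_add]
      | single i k => rw [mon_single, Finsupp.degree_single]
    have h2 : ‖fun _ : Fin n => (s:ℂ)‖ ≤ s := by
      rw [pi_norm_le_iff_of_nonneg hs.le]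
      intro i
      rw [Complex.norm_real, Real.norm_of_nonneg hs.le]
    have h3 := (norm_mon_le (sc T fun _ : Fin n => (s:ℂ)) β).trans (pow_le_one₀ (norm_nonneg _) (hsc _ h2))
    rw [mon_sc, h1, norm_mul, norm_pow, norm_pow, Complex.norm_natCast, Complex.norm_real,
      Real.norm_of_nonneg hs.le] at h3
    rw [norm_mul, norm_pow, Complex.norm_natCast, mul_assoc]
    exact mul_le_of_le_one_right (norm_nonneg _) h3
  · have := ev_hasSum (sc T z) (hsc z hz.le) x
    simp only [mon_sc] at this
    convert this using 2 with β
    · ring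
    · rw [ev_apply]
      simp only [evz]

lemma evz_analytic (T : ℕ) (x : XX n) : AnalyticAt ℂ (evz T x) 0 := by
  obtain ⟨s, hs⟩ := evz_rep T x
  exact hs.analyticAt

end scaling
end JacAux


namespace JacAux
open MvPolynomial Filter Asymptotics
open scoped Topology

section division
variable {n m : ℕ}

/-- membership in the ideal of germs at the origin -/
def Mem (f : Fin m → (Fin n → ℂ) → ℂ) (g : (Fin n → ℂ) → ℂ) : Prop :=
  ∃ a : Fin m → (Fin n → ℂ) → ℂ, (∀ j, AnalyticAt ℂ (a j) 0) ∧ ∀ᶠ z in 𝓝 0, g z = ∑ j, a j z * f j z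

lemma Mem.mul {f : Fin m → (Fin n → ℂ) → ℂ} {g : (Fin n → ℂ) → ℂ} (h : Mem f g)
    {b : (Fin n → ℂ) → ℂ} (hb : AnalyticAt ℂ b 0) : Mem f (fun z => b z * g z) := by
  obtain ⟨a, ha, he⟩ := h
  refine ⟨fun j z => b z * a j z, fun j => hb.mul (ha j), ?_⟩
  filter_upwards [he] with z hz
  rw [hz, Finset.mul_sum]
  simp only [mul_assoc]

lemma Mem.sub {f : Fin m → (Fin n → ℂ) → ℂ} {g g' : (Fin n → ℂ) → ℂ} (h : Mem f g) (h' : Mem f g') :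
    Mem f (fun z => g z - g' z) := by
  obtain ⟨a, ha, he⟩ := h
  obtain ⟨b, hb, he'⟩ := h'
  refine ⟨fun j z => a j z - b j z, fun j => (ha j).sub (hb j), ?_⟩
  filter_upwards [he, he'] with z hz hz'
  rw [hz, hz', ← Finset.sum_sub_distrib]
  simp only [sub_mul]

lemma Mem.sum {k : ℕ} {f : Fin m → (Fin n → ℂ) → ℂ} {g : Fin k → (Fin n → ℂ) → ℂ} (h : ∀ i, Mem f (g i)) :
    Mem f (fun z => ∑ i, g i z) := by
  choose a ha he using h
  refine ⟨fun j z => ∑ i, a i j z, fun j => ?_, ?_⟩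
  · exact Finset.analyticAt_fun_sum _ fun i _ => ha i j
  · filter_upwards [eventually_all.2 he] with z hz
    simp only [hz, Finset.sum_mul]
    rw [Finset.sum_comm]

lemma Mem.analyticAt {f : Fin m → (Fin n → ℂ) → ℂ} (hf : ∀ j, AnalyticAt ℂ (f j) 0)
    {g : (Fin n → ℂ) → ℂ} (h : Mem f g) : AnalyticAt ℂ g 0 := by
  obtain ⟨a, ha, he⟩ := h
  refine AnalyticAt.congr (f := fun z => ∑ j, a j z * f j z) ?_ (he.mono fun z hz => hz.symm)
  exact Finset.analyticAt_fun_sum _ fun j _ => (ha j).mul (hf j)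

/-- leading exponents -/
def Exps (f : Fin m → (Fin n → ℂ) → ℂ) : Set (Fin n →₀ ℕ) :=
  {α | ∃ g r c, Mem f g ∧ Rep g r c ∧ c α = 1 ∧ ∀ β, c β ≠ 0 → NN α ≤ NN β}

lemma exists_gens (E : Set (Fin n →₀ ℕ)) : ∃ (k : ℕ) (α : Fin k → (Fin n →₀ ℕ)), (∀ i, α i ∈ E) ∧
    ∀ β ∈ E, ∃ i, α i ≤ β := by
  have hfin : {x | Minimal (· ∈ E) x}.Finite := by
    apply WellQuasiOrderedLE.finite_of_isAntichain
    exact setOfPred_minimal_antichain _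
  let e := (hfin.toFinset.equivFin).symm
  refine ⟨_, fun i => (e i : Fin n →₀ ℕ), fun i => ?_, fun β hβ => ?_⟩
  · have := (e i).2
    rw [Set.Finite.mem_toFinset] at this
    exact this.1
  · obtain ⟨x, hx, hm⟩ := (Set.isPWO_of_wellQuasiOrderedLE E).exists_le_minimal hβ
    have hx' : x ∈ hfin.toFinset := by rw [Set.Finite.mem_toFinset]; exact hm
    exact ⟨e.symm ⟨x, hx'⟩, by simpa using hx⟩

theorem divisionD {f : Fin m → (Fin n → ℂ) → ℂ} (hf : ∀ j, AnalyticAt ℂ (f j) 0)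
    {h : (Fin n → ℂ) → ℂ} (hh : AnalyticAt ℂ h 0)
    (H : ∀ K : ℕ, ∃ p : Fin m → (Fin n → ℂ) → ℂ, (∀ j, AnalyticAt ℂ (p j) 0) ∧
      (fun z => h z - ∑ j, p j z * f j z) =O[𝓝 0] fun z => ‖z‖ ^ K) : Mem f h := by
  obtain ⟨k, α, hα, hαE⟩ := exists_gens (Exps f)
  choose g r c hg hrep hc1 hlead using hα
  have hT := fun i => scaled_lead (hrep i) (hc1 i) (hlead i)
  choose T1 hT1 using hT
  obtain ⟨r0, c0, hrep0⟩ := exists_rep hh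
  obtain ⟨T2, hT2⟩ := scaled hrep0
  set T := T2 + ∑ i, T1 i with hTdef
  have hle : ∀ i, T ≥ T1 i := fun i =>
    (Finset.single_le_sum (f := T1) (fun _ _ => Nat.zero_le _) (Finset.mem_univ i)).trans (Nat.le_add_left _ _)
  obtain ⟨xh, -, hxh⟩ := hT2 T (Nat.le_add_right _ _)
  have hx := fun i => hT1 i T (hle i)
  choose x hxn hxe using hx
  obtain ⟨y, ρ, hρ, hdiv⟩ := ell1_division α x hxn xh
  obtain ⟨s, hs, hsc⟩ := exists_sc_small (n := n) T
  set q : (Fin n → ℂ) → ℂ := fun z => ∑ i, (evz T (y i) z * (NN (α i) : ℂ) ^ T) * g i z with hq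
  have hqM : Mem f q := Mem.sum fun i => (hg i).mul ((evz_analytic T (y i)).mul analyticAt_const)
  have hdec : ∀ᶠ z in 𝓝 (0 : Fin n → ℂ), h z = q z + evz T ρ z := by
    filter_upwards [Metric.ball_mem_nhds (0 : Fin n → ℂ) hs] with z hz
    rw [mem_ball_zero_iff] at hz
    have h1 := hdiv (sc T z) (hsc z hz.le)
    rw [hxh] at h1
    simp only [hxe] at h1
    rw [h1]
    simp only [ev_apply, hq, evz, mul_assoc]
  have hρ0 : ∀ β, ρ β = 0 := by
    by_contra hne
    push Not at hne
    obtain ⟨β, hβ, hmin⟩ := WellFounded.has_min (measure (NN (n := n))).wf {β | ρ β ≠ 0} hne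
    have hmin' : ∀ γ, ρ γ ≠ 0 → NN β ≤ NN γ := fun γ hγ => not_lt.1 (hmin γ hγ)
    obtain ⟨p, hp, hO⟩ := H (NN β + 1)
    have hGM : Mem f (fun z => (∑ j, p j z * f j z) - q z) := by
      refine Mem.sub ⟨p, hp, Eventually.of_forall fun _ => rfl⟩ hqM
    obtain ⟨rG, cG, hG⟩ := exists_rep (hGM.analyticAt hf)
    obtain ⟨rr, hR⟩ := evz_rep T ρ
    have hsub := hR.sub hG
    have hO' : (fun z => evz T ρ z - ((∑ j, p j z * f j z) - q z)) =O[𝓝 0] fun z : Fin n → ℂ => ‖z‖ ^ (NN β + 1) := by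
      refine hO.congr' ?_ EventuallyEq.rfl
      filter_upwards [hdec] with z hz
      rw [hz]; ring
    have hcoef := hsub.coeff_zero hO'
    have hNT : ∀ γ : Fin n →₀ ℕ, (NN γ : ℂ) ^ T ≠ 0 := fun γ =>
      pow_ne_zero _ (by exact_mod_cast (NN_pos γ).ne')
    have hdβ : β.degree < NN β + 1 :=
      lt_of_lt_of_le Nat.lt_two_pow_self ((two_pow_le_NN β).trans (Nat.le_succ _))
    have hcβ : cG β ≠ 0 := by
      rw [← sub_eq_zero.1 (hcoef β hdβ)]
      exact mul_ne_zero hβ (hNT β)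
    have hE : β ∈ Exps f := by
      refine ⟨_, _, _, hGM.mul (analyticAt_const (v := (cG β)⁻¹)), hG.const_mul (cG β)⁻¹, inv_mul_cancel₀ hcβ, ?_⟩
      intro γ hγ
      have hγ' : cG γ ≠ 0 := right_ne_zero_of_mul hγ
      by_cases hd : γ.degree < NN β + 1
      · apply hmin'
        intro h0
        apply hγ'
        rw [← sub_eq_zero.1 (hcoef γ hd), h0, zero_mul]
      · push Not at hd
        have : 2 ^ (NN β + 1) ≤ 2 ^ γ.degree := Nat.pow_le_pow_right (by norm_num) hd
        have h2 := two_pow_le_NN γ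
        have h3 : NN β + 1 < 2 ^ (NN β + 1) := Nat.lt_two_pow_self
        omega
    obtain ⟨i, hi⟩ := hαE β hE
    exact hβ (hρ i β hi)
  obtain ⟨a, ha, he⟩ := hqM
  refine ⟨a, ha, ?_⟩
  filter_upwards [he, hdec] with z hz hz'
  rw [hz', ← hz]
  simp [evz, hρ0]

end division
end JacAux


namespace JacAux
open MvPolynomial Filter Asymptotics
open scoped Topology

section deriv
variable {n : ℕ}

lemma fderiv_isBigO {E : (Fin n → ℂ) → ℂ} (hE : AnalyticAt ℂ E 0) {K : ℕ}
    (hO : E =O[𝓝 0] fun z => ‖z‖ ^ (K + 1)) (j : Fin n) :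
    (fun z => fderiv ℂ E z (Pi.single j 1)) =O[𝓝 0] fun z => ‖z‖ ^ K := by
  obtain ⟨C, hC, hCb⟩ := hO.exists_pos
  rw [isBigOWith_iff] at hCb
  have hboth := hCb.and hE.eventually_analyticAt
  obtain ⟨R, hR, hball⟩ := Metric.eventually_nhds_iff_ball.1 hboth
  refine IsBigO.of_bound (C * 2 ^ (K + 1)) ?_
  filter_upwards [Metric.ball_mem_nhds (0 : Fin n → ℂ) (show 0 < R / 2 by positivity)] with z hz
  rw [mem_ball_zero_iff] at hz
  rw [norm_pow, norm_norm]
  have key : ∀ ρ : ℝ, ‖z‖ < ρ → ρ < R / 2 →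
      ‖fderiv ℂ E z (Pi.single j 1)‖ ≤ C * 2 ^ (K + 1) * ρ ^ K := by
    intro ρ hzρ hρR
    have hρ : 0 < ρ := (norm_nonneg z).trans_lt hzρ
    have hn1 : ‖(Pi.single j 1 : Fin n → ℂ)‖ = 1 := by rw [Pi.norm_single, norm_one]
    have hin : ∀ t : ℂ, ‖t‖ ≤ ρ → ‖z + t • (Pi.single j 1 : Fin n → ℂ)‖ ≤ 2 * ρ := by
      intro t ht
      refine (norm_add_le _ _).trans ?_
      rw [norm_smul, hn1]
      linarith
    have hda : ∀ t : ℂ, ‖t‖ ≤ ρ → HasDerivAt (fun t : ℂ => E (z + t • (Pi.single j 1 : Fin n → ℂ)))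
        (fderiv ℂ E (z + t • (Pi.single j 1 : Fin n → ℂ)) (Pi.single j 1)) t := by
      intro t ht
      have h1 := (hball (z + t • (Pi.single j 1 : Fin n → ℂ))
        (by rw [mem_ball_zero_iff]; linarith [hin t ht])).2.differentiableAt.hasFDerivAt
      have h2 : HasDerivAt (fun t : ℂ => z + t • (Pi.single j 1 : Fin n → ℂ)) (Pi.single j 1) t := by
        simpa using ((hasDerivAt_id t).smul_const (Pi.single j 1 : Fin n → ℂ)).const_add z
      exact h1.comp_hasDerivAt t h2
    have h3 := Complex.norm_deriv_le_of_forall_mem_sphere_norm_le (c := (0:ℂ)) (R := ρ)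
      (C := C * (2 * ρ) ^ (K + 1))
      (f := fun t : ℂ => E (z + t • (Pi.single j 1 : Fin n → ℂ))) hρ ?_ ?_
    · rw [(hda 0 (by simpa using hρ.le)).deriv] at h3
      rw [zero_smul, add_zero] at h3
      refine h3.trans (le_of_eq ?_)
      rw [mul_pow, pow_succ ρ]
      field_simp
    · refine DifferentiableOn.diffContOnCl_ball (U := Metric.closedBall 0 ρ) ?_ le_rfl
      intro t ht
      exact (hda t (by simpa using ht)).differentiableAt.differentiableWithinAt
    · intro t ht
      have ht' : ‖t‖ ≤ ρ := by simpa using (mem_sphere_iff_norm.1 ht).le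
      refine ((hball _ (by rw [mem_ball_zero_iff]; linarith [hin t ht'])).1).trans ?_
      rw [norm_pow, norm_norm]
      gcongr
      exact hin t ht'
  have hlim : Tendsto (fun ρ : ℝ => C * 2 ^ (K + 1) * ρ ^ K) (𝓝[>] ‖z‖) (𝓝 (C * 2 ^ (K + 1) * ‖z‖ ^ K)) := by
    have : Continuous (fun ρ : ℝ => C * 2 ^ (K + 1) * ρ ^ K) := by fun_prop
    exact (this.tendsto _).mono_left nhdsWithin_le_nhds
  refine ge_of_tendsto hlim ?_
  filter_upwards [Ioo_mem_nhdsGT hz] with ρ hρ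
  exact key ρ hρ.1 hρ.2

lemma analyticAt_eval (p : MvPolynomial (Fin n) ℂ) (z : Fin n → ℂ) : AnalyticAt ℂ (fun z => eval z p) z := by
  have := AnalyticOnNhd.eval_mvPolynomial (𝕜 := ℂ) p
  exact this z (Set.mem_univ _)

lemma fderiv_eval (p : MvPolynomial (Fin n) ℂ) (z : Fin n → ℂ) (j : Fin n) :
    fderiv ℂ (fun z => eval z p) z (Pi.single j 1) = eval z (pderiv j p) := by
  induction p using MvPolynomial.induction_on with
  | C a => simp
  | add p q hp hq =>
    simp only [map_add]
    rw [fderiv_fun_add (analyticAt_eval p z).differentiableAt (analyticAt_eval q z).differentiableAt,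
      ContinuousLinearMap.add_apply, hp, hq]
  | mul_X p i hp =>
    simp only [map_mul, eval_X]
    have hd : HasFDerivAt (fun z : Fin n → ℂ => z i) (ContinuousLinearMap.proj (R := ℂ) (φ := fun _ : Fin n => ℂ) i) z :=
      hasFDerivAt_apply i z
    rw [fderiv_fun_mul (analyticAt_eval p z).differentiableAt hd.differentiableAt, hd.fderiv]
    simp only [ContinuousLinearMap.add_apply, ContinuousLinearMap.smul_apply, hp,
      ContinuousLinearMap.proj_apply, smul_eq_mul, Derivation.leibniz, pderiv_X, map_add, map_mul, eval_X]
    by_cases hij : i = j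
    · subst hij; simp
    · simp [hij]

lemma coord_isBigO (i : Fin n) : (fun z : Fin n → ℂ => z i) =O[𝓝 0] fun z => ‖z‖ :=
  IsBigO.of_bound 1 (Eventually.of_forall fun z => by simpa using norm_le_pi_norm z i)

lemma analytic_isBigO_one {g : (Fin n → ℂ) → ℂ} (hg : AnalyticAt ℂ g 0) :
    g =O[𝓝 0] fun _ => (1 : ℝ) := hg.continuousAt.isBigO_one ℝ

/-- polynomials vanishing to order `K` -/
def OI (n K : ℕ) : Ideal (MvPolynomial (Fin n) ℂ) where
  carrier := {p | (fun z => eval z p) =O[𝓝 0] fun z : Fin n → ℂ => ‖z‖ ^ K}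
  add_mem' := by
    intro a b ha hb
    simp only [Set.mem_setOf_eq, map_add] at *
    exact ha.add hb
  zero_mem' := by
    simp only [Set.mem_setOf_eq, map_zero]
    exact isBigO_zero _ _
  smul_mem' := by
    intro c x hx
    simp only [Set.mem_setOf_eq, smul_eq_mul, map_mul] at *
    simpa using (analytic_isBigO_one (analyticAt_eval c 0)).mul hx

lemma pow_le_OI (n K : ℕ) : (Ideal.span (Set.range (X : Fin n → MvPolynomial (Fin n) ℂ))) ^ K ≤ OI n K := by
  induction K with
  | zero =>
    intro p _
    change (fun z => eval z p) =O[𝓝 0] fun z : Fin n → ℂ => ‖z‖ ^ 0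
    simpa using analytic_isBigO_one (analyticAt_eval p 0)
  | succ K ih =>
    have h1 : Ideal.span (Set.range (X : Fin n → MvPolynomial (Fin n) ℂ)) ≤ OI n 1 := by
      rw [Ideal.span_le]
      rintro _ ⟨i, rfl⟩
      change (fun z => eval z (X i)) =O[𝓝 0] fun z : Fin n → ℂ => ‖z‖ ^ 1
      simpa using coord_isBigO i
    rw [pow_succ, Ideal.mul_le]
    intro r hr s hs
    have a1 : (fun z => eval z r) =O[𝓝 0] fun z : Fin n → ℂ => ‖z‖ ^ K := ih hr
    have a2 : (fun z => eval z s) =O[𝓝 0] fun z : Fin n → ℂ => ‖z‖ ^ 1 := h1 hs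
    change (fun z => eval z (r * s)) =O[𝓝 0] fun z : Fin n → ℂ => ‖z‖ ^ (K + 1)
    simpa [pow_succ] using a1.mul a2

lemma prod_sub_isBigO {ι : Type*} (s : Finset ι) {a b : ι → (Fin n → ℂ) → ℂ} {K : ℕ}
    (ha : ∀ i, a i =O[𝓝 0] fun _ => (1:ℝ)) (hb : ∀ i, b i =O[𝓝 0] fun _ => (1:ℝ))
    (hab : ∀ i, (fun z => a i z - b i z) =O[𝓝 0] fun z => ‖z‖ ^ K) :
    (fun z => ∏ i ∈ s, a i z) =O[𝓝 0] (fun _ => (1:ℝ)) ∧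
    (fun z => ∏ i ∈ s, a i z - ∏ i ∈ s, b i z) =O[𝓝 0] fun z => ‖z‖ ^ K := by
  classical
  induction s using Finset.induction_on with
  | empty =>
    simp only [Finset.prod_empty, sub_self]
    exact ⟨isBigO_const_const _ one_ne_zero _, isBigO_zero _ _⟩
  | insert i s hi ih =>
    simp only [Finset.prod_insert hi]
    refine ⟨by simpa using (ha i).mul ih.1, ?_⟩
    have h1 := (hab i).mul ih.1
    have h2 := (hb i).mul ih.2
    simp only [mul_one, one_mul] at h1 h2
    refine (h1.add h2).congr_left fun z => ?_
    ring

lemma det_sub_isBigO {a b : Fin n → Fin n → (Fin n → ℂ) → ℂ} {K : ℕ}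
    (ha : ∀ i j, a i j =O[𝓝 0] fun _ => (1:ℝ)) (hb : ∀ i j, b i j =O[𝓝 0] fun _ => (1:ℝ))
    (hab : ∀ i j, (fun z => a i j z - b i j z) =O[𝓝 0] fun z => ‖z‖ ^ K) :
    (fun z => Matrix.det (Matrix.of fun i j => a i j z) - Matrix.det (Matrix.of fun i j => b i j z))
      =O[𝓝 0] fun z => ‖z‖ ^ K := by
  simp only [Matrix.det_apply', Matrix.of_apply, ← Finset.sum_sub_distrib, ← mul_sub]
  refine IsBigO.fun_sum fun σ _ => ?_
  exact (prod_sub_isBigO Finset.univ (a := fun i => a (σ i) i) (b := fun i => b (σ i) i)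
    (fun i => ha _ _) (fun i => hb _ _) (fun i => hab _ _)).2.const_mul_left _

lemma analyticAt_jac {f : Fin n → (Fin n → ℂ) → ℂ} (hf : ∀ i, AnalyticAt ℂ (f i) 0) :
    AnalyticAt ℂ (fun z => Matrix.det (Matrix.of fun i j : Fin n => fderiv ℂ (f i) z (Pi.single j 1))) 0 := by
  simp only [Matrix.det_apply', Matrix.of_apply]
  refine Finset.analyticAt_fun_sum _ fun σ _ => analyticAt_const.mul ?_
  refine Finset.analyticAt_fun_prod _ fun i _ => ?_
  exact ((ContinuousLinearMap.apply ℂ ℂ (Pi.single i 1 : Fin n → ℂ)).analyticAt _).comp (hf (σ i)).fderiv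

end deriv
end JacAux


namespace JacAux
open MvPolynomial Filter Asymptotics
open scoped Topology

section zeros
variable {n : ℕ}

theorem theoremZ {f : Fin n → (Fin n → ℂ) → ℂ} (hf : ∀ i, AnalyticAt ℂ (f i) 0) (i0 : Fin n)
    (h0 : ∀ i, i ≠ i0 → f i 0 = 0)
    (hiso : ∀ᶠ z in 𝓝 (0 : Fin n → ℂ), (∀ i, i ≠ i0 → f i z = 0) → z = 0) : False := by
  classical
  choose r c hrep using fun i => exists_rep (hf i)
  have hev : ∀ᶠ z in 𝓝 (0 : Fin n → ℂ), (((∀ i, i ≠ i0 → f i z = 0) → z = 0) ∧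
      (∀ i, ContinuousAt (f i) z)) ∧ ∀ i, ‖z‖ < r i / 2 := by
    refine (hiso.and ?_).and ?_
    · exact eventually_all.2 fun i => (hf i).eventually_continuousAt
    · refine eventually_all.2 fun i => ?_
      filter_upwards [Metric.ball_mem_nhds (0 : Fin n → ℂ) (half_pos (hrep i).1)] with z hz
      simpa using hz
  obtain ⟨R, hR, hball⟩ := Metric.eventually_nhds_iff_ball.1 hev
  obtain ⟨ε, hε0, hε1, hεR⟩ : ∃ ε : ℝ, 0 < ε ∧ ε ≤ 1 ∧ ε < R :=
    ⟨min 1 (R / 2), by positivity, min_le_left _ _, (min_le_right _ _).trans_lt (by linarith)⟩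
  have hin : ∀ z : Fin n → ℂ, ‖z‖ ≤ ε → z ∈ Metric.ball (0 : Fin n → ℂ) R := fun z hz => by
    rw [mem_ball_zero_iff]; linarith
  -- minimum on the sphere
  set m : (Fin n → ℂ) → ℝ := fun z => ∑ i ∈ Finset.univ.erase i0, ‖f i z‖ with hm
  have hmc : ContinuousOn m (Metric.sphere (0 : Fin n → ℂ) ε) := by
    refine continuousOn_finsetSum _ fun i _ => ?_
    intro z hz
    exact ((hball z (hin z (by simpa using (mem_sphere_iff_norm.1 hz).le))).1.2 i).norm.continuousWithinAt
  have hmpos : ∀ z ∈ Metric.sphere (0 : Fin n → ℂ) ε, 0 < m z := by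
    intro z hz
    have hzn : ‖z‖ = ε := by simpa using hz
    refine lt_of_le_of_ne (Finset.sum_nonneg fun _ _ => norm_nonneg _) fun h => ?_
    have h1 := (Finset.sum_eq_zero_iff_of_nonneg (fun _ _ => norm_nonneg _)).1 h.symm
    have h2 : z = 0 := (hball z (hin z hzn.le)).1.1 fun i hi =>
      norm_eq_zero.1 (h1 i (Finset.mem_erase.2 ⟨hi, Finset.mem_univ _⟩))
    rw [h2, norm_zero] at hzn
    exact hε0.ne hzn
  obtain ⟨c0, hc0, hmin⟩ := (isCompact_sphere (0 : Fin n → ℂ) ε).exists_forall_le' hmc hmpos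
  -- choice of parameters
  set M : ℝ := ∑ i, ∑' α, ‖c i α‖ * r i ^ α.degree with hM
  have hMi0 : ∀ i, 0 ≤ ∑' α, ‖c i α‖ * r i ^ α.degree := fun i =>
    tsum_nonneg fun α => mul_nonneg (norm_nonneg _) (pow_nonneg (hrep i).1.le _)
  have hMi : ∀ i, ∑' α, ‖c i α‖ * r i ^ α.degree ≤ M := fun i =>
    Finset.single_le_sum (f := fun i => ∑' α, ‖c i α‖ * r i ^ α.degree) (fun i _ => hMi0 i) (Finset.mem_univ i)
  have hM0 : 0 ≤ M := Finset.sum_nonneg fun i _ => hMi0 i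
  obtain ⟨δ, hδ, hδn⟩ : ∃ δ : ℝ, 0 < δ ∧ n * (2 * δ) < c0 := by
    refine ⟨c0 / (2 * (n + 1)), by positivity, ?_⟩
    have : (n:ℝ) * (2 * (c0 / (2 * (n + 1)))) = c0 * (n / (n + 1)) := by field_simp
    rw [this]
    refine mul_lt_of_lt_one_right hc0 ?_
    rw [div_lt_one (by positivity)]
    linarith
  obtain ⟨S, hS⟩ := exists_pow_lt_of_lt_one (show (0:ℝ) < δ / (M + 1) by positivity) (show (1/2:ℝ) < 1 by norm_num)
  set L := S + 1 with hLdef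
  have hL : 0 < L := Nat.succ_pos _
  have hLM : (1/2:ℝ) ^ L * M ≤ δ := by
    have h1 : (1/2:ℝ) ^ L ≤ δ / (M + 1) :=
      (pow_le_pow_of_le_one (by norm_num) (by norm_num) (Nat.le_succ S)).trans hS.le
    calc (1/2:ℝ) ^ L * M ≤ δ / (M + 1) * (M + 1) := by gcongr; linarith
      _ = δ := by field_simp
  have hδC : (δ : ℂ) ≠ 0 := by exact_mod_cast hδ.ne'
  set P : Fin n → MvPolynomial (Fin n) ℂ := fun i => if i = i0 then 0 else (δ : ℂ)⁻¹ • trunc (c i) L with hPdef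
  have hP : ∀ i, P i ∈ Wd (Fin n) L := by
    intro i
    simp only [hPdef]
    split_ifs
    · exact Submodule.zero_mem _
    · exact Submodule.smul_mem _ _ (trunc_mem _ _)
  have hFMi : ∀ z i, i ≠ i0 → (δ : ℂ) * FM L P z i = eval z (trunc (c i) L) + δ * z i ^ L := by
    intro z i hi
    simp only [FM, FF, hPdef, if_neg hi, map_add, smul_eval, map_pow, eval_X]
    field_simp
  have hFM0 : ∀ z, FM L P z i0 = z i0 ^ L := by
    intro z
    simp [FM, FF, hPdef]
  -- no zeros on the sphere
  have hsph : ∀ z : Fin n → ℂ, ‖z‖ = ε → ∀ s : ℂ, FM L P z ≠ Pi.single i0 s := by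
    intro z hz s hs
    have hb : ∀ i ∈ Finset.univ.erase i0, ‖f i z‖ ≤ 2 * δ := by
      intro i hi
      have hi' := Finset.ne_of_mem_erase hi
      have h1 := hFMi z i hi'
      rw [hs, Pi.single_eq_of_ne hi', mul_zero] at h1
      have hzr := (hball z (hin z hz.le)).2 i
      have hri := (hrep i).1
      have h2 := (hrep i).trunc_bound L z (by linarith)
      have h3 : f i z = (f i z - eval z (trunc (c i) L)) - δ * z i ^ L := by
        linear_combination (-1 : ℂ) * h1
      rw [h3]
      refine (norm_sub_le _ _).trans ?_
      have h4 : ‖(δ : ℂ) * z i ^ L‖ ≤ δ := by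
        rw [norm_mul, Complex.norm_real, Real.norm_of_nonneg hδ.le, norm_pow]
        refine mul_le_of_le_one_right hδ.le (pow_le_one₀ (norm_nonneg _) ?_)
        exact (norm_le_pi_norm z i).trans (hz.le.trans hε1)
      have h5 : (‖z‖ / r i) ^ L * ∑' α, ‖c i α‖ * r i ^ α.degree ≤ (1/2:ℝ) ^ L * M := by
        have : ‖z‖ / r i ≤ 1 / 2 := by rw [div_le_iff₀ hri]; linarith
        have := hMi i
        have := hMi0 i
        gcongr
      linarith
    have h6 : m z ≤ n * (2 * δ) := by
      refine (Finset.sum_le_card_nsmul _ _ _ hb).trans ?_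
      rw [nsmul_eq_mul]
      have : ((Finset.univ.erase i0).card : ℝ) ≤ n := by
        exact_mod_cast (Finset.card_le_univ _).trans (by simp)
      gcongr
    have := hmin z (by simpa using hz)
    linarith
  -- connectedness
  have hcs : Continuous fun s : ℂ => (Pi.single i0 s : Fin n → ℂ) := by
    refine continuous_pi fun j => ?_
    simp only [Pi.single_apply]
    split_ifs
    · exact continuous_id
    · exact continuous_const
  set A : Set ℂ := (fun s : ℂ => (Pi.single i0 s : Fin n → ℂ)) ⁻¹' (FM L P '' Metric.ball 0 ε) with hA
  have hAo : IsOpen A := (open_FM hL hP _ Metric.isOpen_ball).preimage hcs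
  have hAc : IsClosed A := by
    have h1 : A = (fun s : ℂ => (Pi.single i0 s : Fin n → ℂ)) ⁻¹' (FM L P '' Metric.closedBall 0 ε) := by
      ext s
      constructor
      · rintro ⟨z, hz, he⟩
        exact ⟨z, Metric.ball_subset_closedBall hz, he⟩
      · rintro ⟨z, hz, he⟩
        refine ⟨z, ?_, he⟩
        rw [mem_closedBall_zero_iff] at hz
        rw [mem_ball_zero_iff]
        exact lt_of_le_of_ne hz fun h => hsph z h s he
    rw [h1]
    exact (((isCompact_closedBall (0 : Fin n → ℂ) ε).image (continuous_FM L P)).isClosed).preimage hcs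
  have hA0 : (0 : ℂ) ∈ A := by
    refine ⟨0, by simpa using hε0, ?_⟩
    ext i
    simp only [Pi.single_zero, Pi.zero_apply]
    by_cases hi : i = i0
    · rw [hi, hFM0]; simp [hL.ne']
    · have h1 := hFMi 0 i hi
      have h2 := (hrep i).trunc_bound L 0 (by simpa using (hrep i).1)
      rw [h0 i hi] at h2
      simp only [norm_zero, zero_div, zero_pow hL.ne', zero_mul, zero_sub, norm_neg] at h2
      rw [norm_le_zero_iff.1 h2] at h1
      simpa [hL.ne', hδC] using h1
  have hAu := IsClopen.eq_univ ⟨hAc, hAo⟩ ⟨0, hA0⟩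
  obtain ⟨z, hz, he⟩ : (2 : ℂ) ∈ A := by rw [hAu]; trivial
  rw [mem_ball_zero_iff] at hz
  have h1 := congrFun he i0
  rw [hFM0] at h1
  simp only [Pi.single_eq_same] at h1
  have h2 : ‖z i0 ^ L‖ ≤ 1 := by
    rw [norm_pow]
    exact pow_le_one₀ (norm_nonneg _) ((norm_le_pi_norm z i0).trans (hz.le.trans hε1))
  rw [h1] at h2
  norm_num at h2

end zeros
end JacAux


namespace JacAux
open MvPolynomial Filter Asymptotics
open scoped Topology

section glue
variable {n : ℕ}

lemma approx {f : Fin n → (Fin n → ℂ) → ℂ} (hf : ∀ i, AnalyticAt ℂ (f i) 0)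
    (hiso : ¬ ∀ᶠ z in 𝓝 (0 : Fin n → ℂ), (∀ i, f i z = 0) → z = 0) (K : ℕ) (hK : 0 < K) :
    ∃ p : Fin n → (Fin n → ℂ) → ℂ, (∀ j, AnalyticAt ℂ (p j) 0) ∧
      (fun z => Matrix.det (Matrix.of fun i j : Fin n => fderiv ℂ (f i) z (Pi.single j 1))
        - ∑ j, p j z * f j z) =O[𝓝 0] fun z => ‖z‖ ^ K := by
  classical
  choose r c hrep using fun i => exists_rep (hf i)
  set P : Fin n → MvPolynomial (Fin n) ℂ := fun i => trunc (c i) (K + 1) with hPdef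
  have hP : ∀ i, P i ∈ Wd (Fin n) (K + 1) := fun i => trunc_mem _ _
  set F := FF (K + 1) P with hF
  have hfF : ∀ i, (fun z => f i z - eval z (F i)) =O[𝓝 0] fun z : Fin n → ℂ => ‖z‖ ^ (K + 1) := by
    intro i
    refine (((hrep i).trunc_isBigO (K + 1)).sub ((coord_isBigO i).pow (K + 1))).congr_left fun z => ?_
    simp only [hF, FF, hPdef, map_add, map_pow, eval_X]
    ring
  have hqO : ∀ q : Fin n → MvPolynomial (Fin n) ℂ,
      (fun z => ∑ i, eval z (q i) * (f i z - eval z (F i))) =O[𝓝 0] fun z : Fin n → ℂ => ‖z‖ ^ (K + 1) := by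
    intro q
    refine IsBigO.fun_sum fun i _ => ?_
    simpa using (analytic_isBigO_one (analyticAt_eval (q i) 0)).mul (hfF i)
  have hlo : (fun z : Fin n → ℂ => ‖z‖ ^ (K + 1)) =o[𝓝 0] fun z => ‖z‖ ^ K := by
    have h1 : (fun z : Fin n → ℂ => ‖z‖) =o[𝓝 0] fun _ => (1:ℝ) := by
      rw [isLittleO_one_iff]
      exact tendsto_norm_zero
    simpa [pow_succ] using (isBigO_refl (fun z : Fin n → ℂ => ‖z‖ ^ K) (𝓝 0)).mul_isLittleO h1
  have hT := theoremT (Nat.succ_pos K) hP K ?_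
  · obtain ⟨u, hu, v, hv, huv⟩ := Submodule.mem_sup.1 hT
    obtain ⟨q, hq⟩ := (Ideal.mem_span_range_iff_exists_fun).1 hu
    refine ⟨fun j z => eval z (q j), fun j => analyticAt_eval _ _, ?_⟩
    have hvO : (fun z => eval z v) =O[𝓝 0] fun z : Fin n → ℂ => ‖z‖ ^ K := pow_le_OI n K hv
    have hder : ∀ i j, (fun z => fderiv ℂ (f i) z (Pi.single j 1) - eval z (pderiv j (F i))) =O[𝓝 0]
        fun z : Fin n → ℂ => ‖z‖ ^ K := by
      intro i j
      refine (fderiv_isBigO ((hf i).sub (analyticAt_eval (F i) 0)) (hfF i) j).congr' ?_ EventuallyEq.rfl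
      filter_upwards [(hf i).eventually_analyticAt] with z hz
      rw [← fderiv_eval]
      have := fderiv_fun_sub hz.differentiableAt (analyticAt_eval (F i) z).differentiableAt
      have h2 := congrArg (fun l => l (Pi.single j 1)) this
      exact h2
    have hdet := det_sub_isBigO (a := fun i j z => fderiv ℂ (f i) z (Pi.single j 1))
      (b := fun i j z => eval z (pderiv j (F i)))
      (fun i j => analytic_isBigO_one
        (((ContinuousLinearMap.apply ℂ ℂ (Pi.single j 1 : Fin n → ℂ)).analyticAt _).comp (hf i).fderiv))
      (fun i j => analytic_isBigO_one (analyticAt_eval _ _)) hder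
    refine ((hdet.add hvO).sub ((hqO q).trans hlo.isBigO)).congr_left fun z => ?_
    have h3 : Matrix.det (Matrix.of fun i j => eval z (pderiv j (F i))) = eval z u + eval z v := by
      rw [← map_add, huv, RingHom.map_det]
      rfl
    rw [h3, ← hq]
    simp only [map_sum, map_mul, mul_sub, Finset.sum_sub_distrib]
    ring
  · intro g hg
    by_contra hcon
    push Not at hcon
    apply hiso
    have hX : ∀ j : Fin n, ∃ q : Fin n → MvPolynomial (Fin n) ℂ, ∑ i, q i * F i = g * X j ^ K := by
      intro j
      exact (Ideal.mem_span_range_iff_exists_fun).1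
        (hcon (X j ^ K) (Ideal.pow_mem_pow (Ideal.subset_span (Set.mem_range_self j)) K))
    choose q hq using hX
    have hg0 : 0 < ‖eval 0 g‖ := norm_pos_iff.2 hg
    have hgc : ∀ᶠ z in 𝓝 (0 : Fin n → ℂ), ‖eval 0 g‖ / 2 < ‖eval z g‖ := by
      have h1 : ContinuousAt (fun z : Fin n → ℂ => ‖eval z g‖) 0 := (analyticAt_eval g 0).continuousAt.norm
      exact h1.eventually_const_lt (half_lt_self hg0)
    have hsm : ∀ᶠ z in 𝓝 (0 : Fin n → ℂ), ∀ j, ‖∑ i, eval z (q j i) * (f i z - eval z (F i))‖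
        ≤ ‖eval 0 g‖ / 4 * ‖‖z‖ ^ K‖ := by
      refine eventually_all.2 fun j => ?_
      exact ((hqO (q j)).trans_isLittleO hlo).def (by positivity)
    filter_upwards [hgc, hsm] with z h1 h2 h3
    by_contra hz
    have hzpos : 0 < ‖z‖ := norm_pos_iff.2 hz
    have hlt : ∀ j, ‖z j‖ < ‖z‖ := by
      intro j
      have h4 := h2 j
      have h5 : ∑ i, eval z (q j i) * (f i z - eval z (F i)) = - (eval z g * z j ^ K) := by
        have h6 := congrArg (eval z) (hq j)
        simp only [map_sum, map_mul, map_pow, eval_X] at h6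
        rw [← h6]
        simp [h3]
      rw [h5, norm_neg, norm_mul, norm_pow, norm_pow, norm_norm] at h4
      refine lt_of_pow_lt_pow_left₀ K hzpos.le ?_
      have h7 : 0 < ‖z‖ ^ K := by positivity
      have h8 : 0 ≤ ‖z j‖ ^ K := by positivity
      nlinarith
    exact lt_irrefl _ ((pi_norm_lt_iff hzpos).2 hlt)

theorem core {f : Fin n → (Fin n → ℂ) → ℂ} (hf : ∀ i, AnalyticAt ℂ (f i) 0)
    (hiso : ¬ ∀ᶠ z in 𝓝 (0 : Fin n → ℂ), (∀ i, f i z = 0) → z = 0) :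
    Mem f (fun z => Matrix.det (Matrix.of fun i j : Fin n => fderiv ℂ (f i) z (Pi.single j 1))) := by
  refine divisionD hf (analyticAt_jac hf) fun K => ?_
  obtain ⟨p, hp, hO⟩ := approx hf hiso (K + 1) (Nat.succ_pos K)
  refine ⟨p, hp, hO.trans ?_⟩
  refine IsBigO.of_bound 1 ?_
  filter_upwards [Metric.ball_mem_nhds (0 : Fin n → ℂ) one_pos] with z hz
  rw [mem_ball_zero_iff] at hz
  rw [one_mul, norm_pow, norm_pow, norm_norm]
  exact pow_le_pow_of_le_one (norm_nonneg _) hz.le (Nat.le_succ K)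

theorem core' {f : Fin n → (Fin n → ℂ) → ℂ} (hf : ∀ i, AnalyticAt ℂ (f i) 0) (i0 : Fin n)
    (hV : ∀ᶠ z in 𝓝 (0 : Fin n → ℂ), (∀ i, i ≠ i0 → f i z = 0) → f i0 z = 0) :
    Mem f (fun z => Matrix.det (Matrix.of fun i j : Fin n => fderiv ℂ (f i) z (Pi.single j 1))) := by
  classical
  by_cases h0 : ∀ i, f i 0 = 0
  · refine core hf fun h => theoremZ hf i0 (fun i _ => h0 i) ?_
    filter_upwards [h, hV] with z h1 h2 h3
    refine h1 fun i => ?_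
    by_cases hi : i = i0
    · rw [hi]; exact h2 h3
    · exact h3 i hi
  · push Not at h0
    obtain ⟨k, hk⟩ := h0
    refine ⟨fun i z => if i = k then
      Matrix.det (Matrix.of fun i j : Fin n => fderiv ℂ (f i) z (Pi.single j 1)) / f k z else 0, fun j => ?_, ?_⟩
    · by_cases hj : j = k
      · simp only [if_pos hj]
        exact (analyticAt_jac hf).div (hf k) hk
      · simp only [if_neg hj]
        exact analyticAt_const
    · filter_upwards [(hf k).continuousAt.eventually_ne hk] with z hz
      simp only [ite_mul, zero_mul, Finset.sum_ite_eq', Finset.mem_univ, if_true]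
      rw [div_mul_cancel₀ _ hz]

end glue
end JacAux

theorem jacobian_mem_ideal_of_zero_set_eq_holomorphic
    (n : ℕ) (hn : 0 < n) (U : Set (Fin n → ℂ)) (hU : IsOpen U)
    (h0U : (0 : Fin n → ℂ) ∈ U)
    (f : Fin n → (Fin n → ℂ) → ℂ) (hf : ∀ i, AnalyticOnNhd ℂ (f i) U)
    (ν : ℕ) (hν : 0 < ν) (hνn : ν < n)
    (hV : ∃ V ⊆ U, IsOpen V ∧ (0 : Fin n → ℂ) ∈ V ∧
      ∀ z ∈ V, (∀ i : Fin n, (i : ℕ) < ν → f i z = 0) → ∀ i : Fin n, f i z = 0) :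
    ∃ U' ⊆ U, IsOpen U' ∧ (0 : Fin n → ℂ) ∈ U' ∧
      ∃ a : Fin n → (Fin n → ℂ) → ℂ,
        (∀ i, AnalyticOnNhd ℂ (a i) U') ∧
        ∀ z ∈ U', Matrix.det (Matrix.of fun i j : Fin n =>
            fderiv ℂ (f i) z (Pi.single j 1)) = ∑ i, a i z * f i z := by
  obtain ⟨V, hVU, hVo, h0V, hVz⟩ := hV
  obtain ⟨a, ha, he⟩ := JacAux.core' (fun i => hf i 0 h0U) ⟨ν, hνn⟩ (by
    filter_upwards [hVo.mem_nhds h0V] with z hz h1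
    refine hVz z hz (fun i hi => h1 i fun h => ?_) _
    rw [h] at hi
    exact lt_irrefl _ hi)
  have hev := (he.and (Filter.eventually_all.2 fun i => (ha i).eventually_analyticAt)).and (hU.mem_nhds h0U)
  obtain ⟨W, hW, hWo, h0W⟩ := eventually_nhds_iff.1 hev
  exact ⟨W, fun z hz => (hW z hz).2, hWo, h0W, a, fun i z hz => (hW z hz).1.2 i, fun z hz => (hW z hz).1.1⟩
end
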